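/- For |q|<1, φ⁴(q)·φ⁴(q³) = 1 + (8/5)·∑_{j≥1} ( j³q^j/(1−q^j) − 2j³q^{2j}/(1−q^{2j}) + 9j³q^{3j}/(1−q^{3j}) + 16j³q^{4j}/(1−q^{4j}) − 18j³q^{6j}/(1−q^{6j}) + 144j³q^{12j}/(1−q^{12j}) ) + (32/5)·η₂⁸η₆⁸/(η₁²η₃²η₄²η₁₂²), where η_m denotes the eta-product q^{m/24}∏_{n≥1}(1−q^{mn}). -/

import Mathlib

noncomputable section

section LevelOne

open Complex UpperHalfPlane ModularForm Filter Topology Asymptotics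
open scoped Real MatrixGroups Manifold

lemma slash_T_apply (f : ℍ → ℂ) (k : ℤ) (z : ℍ) :
    (f ∣[k] ModularGroup.T) z = f ((1 : ℝ) +ᵥ z) := by
  have : denom ModularGroup.T z = 1 := by
    rw [ModularGroup.denom_apply]; simp [ModularGroup.T]
  rw [SL_slash_apply, modular_T_smul, this]
  simp

lemma levelOne_eq_zero_of_isBigO (n : ℕ) {c : ℝ} (hc : 2 * π * n < c) {F : ℂ → ℂ}
    (hd : DifferentiableOn ℂ F upperHalfPlaneSet) (hT : ∀ τ ∈ upperHalfPlaneSet, F (τ + 1) = F τ)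
    (hS : ∀ τ ∈ upperHalfPlaneSet, F (-1 / τ) = τ ^ (12 * n) * F τ)
    (hO : F =O[comap Complex.im atTop] fun τ ↦ Real.exp (-c * τ.im)) :
    ∀ τ ∈ upperHalfPlaneSet, F τ = 0 := by
  set f : ℍ → ℂ := fun z ↦ F z / discriminant z ^ n with hf
  have h1 : f ∣[(0 : ℤ)] ModularGroup.T = f := by
    ext z
    have hΔ : discriminant ((1 : ℝ) +ᵥ z) = discriminant z := by
      rw [← slash_T_apply discriminant 12, discriminant_T_invariant]
    rw [slash_T_apply]
    simp [hf, hΔ, add_comm (1 : ℂ), hT z z.2]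
  have h2 : f ∣[(0 : ℤ)] ModularGroup.S = f := by
    ext z
    have hΔ : discriminant (.mk _ z.im_inv_neg_coe_pos) = (z : ℂ) ^ 12 * discriminant z := by
      have := congrFun discriminant_S_invariant z
      rw [SlashInvariantForm.slash_S_apply] at this
      have hz := z.ne_zero
      rw [← this]
      field_simp
    rw [SlashInvariantForm.slash_S_apply]
    have hz := z.ne_zero
    have := hS z z.2
    simp only [hf, hΔ]
    rw [show (-(z : ℂ))⁻¹ = -1 / z by
      simp [neg_div], this, mul_pow, ← pow_mul]
    simp [mul_div_mul_left _ _ (pow_ne_zero _ hz)]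
  have h3 : Tendsto f atImInfty (𝓝 0) := by
    have e1 : (fun z : ℍ ↦ F z) =O[atImInfty] fun z : ℍ ↦ Real.exp (-c * z.im) :=
      hO.comp_tendsto (k := (fun z : ℍ ↦ (z : ℂ))) (by
        rw [atImInfty, tendsto_comap_iff]; exact tendsto_comap)
    have e2 := exp_isBigO_discriminant.pow n
    have e3 : (fun z : ℍ ↦ F z) =o[atImInfty] fun z ↦ discriminant z ^ n := by
      refine e1.trans_isLittleO (IsLittleO.trans_isBigO ?_ e2)
      have : Tendsto (fun z : ℍ ↦ z.im) atImInfty atTop := tendsto_comap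
      have h4 : (fun x : ℝ ↦ Real.exp (-c * x)) =o[atTop] fun x ↦ Real.exp (-2 * π * x) ^ n := by
        simp_rw [← Real.exp_nat_mul]
        rw [Real.isLittleO_exp_comp_exp_comp]
        have : (fun x : ℝ ↦ ↑n * (-2 * π * x) - -c * x) = fun x ↦ (c - 2 * π * n) * x := by
          ext; ring
        rw [this]
        exact tendsto_id.const_mul_atTop (by linarith)
      exact h4.comp_tendsto this
    exact e3.tendsto_div_nhds_zero
  have h5 := SlashInvariantForm.slash_action_generators_SL2Z h2 h1
  let g : ModularForm 𝒮ℒ 0 :=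
    { toFun := f
      slash_action_eq' := fun _ ⟨γ, hγ⟩ ↦ hγ ▸ h5 γ
      holo' := by
        refine .div ?_ (.pow CuspForm.discriminant.holo' n) fun z ↦ pow_ne_zero _ (discriminant_ne_zero z)
        rw [UpperHalfPlane.mdifferentiable_iff]
        exact hd.congr fun z hz ↦ by simp [ofComplex_apply_of_im_pos hz]
      bdd_at_cusps' {c} hc := by
        rw [Subgroup.IsArithmetic.isCusp_iff_isCusp_SL2Z] at hc
        rw [OnePoint.isBoundedAt_iff_forall_SL2Z hc]
        intro γ _
        rw [h5 γ, IsBoundedAtImInfty, BoundedAtFilter]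
        exact h3.isBigO_one ℝ }
  obtain ⟨a, ha⟩ := ModularFormClass.levelOne_weight_zero_const g
  have ha' : f = Function.const _ a := ha
  have ha0 : a = 0 := by
    rw [ha'] at h3
    exact tendsto_nhds_unique tendsto_const_nhds h3
  intro τ hτ
  have := congrFun ha' ⟨τ, hτ⟩
  simpa [hf, ha0, discriminant_ne_zero] using this

end LevelOne

section Theta

open Complex Filter Topology Asymptotics
open UpperHalfPlane hiding I
open scoped Real

/-- Jacobi's theta function `θ₃(τ) = ∑ e^{π i n² τ}`. -/
def theta3 (τ : ℂ) : ℂ := jacobiTheta₂ 0 τ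

/-- Jacobi's theta function `θ₄(τ) = ∑ (-1)ⁿ e^{π i n² τ}`. -/
def theta4 (τ : ℂ) : ℂ := jacobiTheta₂ (1 / 2) τ

/-- Jacobi's theta function `θ₂(τ) = ∑ e^{π i (n + 1/2)² τ}`. -/
def theta2 (τ : ℂ) : ℂ := cexp (π * I * τ / 4) * jacobiTheta₂ (τ / 2) τ

lemma exp_eq_exp_of_eq_add_even {a b : ℂ} {m : ℤ} (hm : Even m) (h : a = b + π * I * m) :
    cexp a = cexp b := by
  obtain ⟨k, rfl⟩ := hm
  rw [exp_eq_exp_iff_exists_int]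
  exact ⟨k, by rw [h]; push_cast; ring⟩

lemma theta3_add_one (τ : ℂ) : theta3 (τ + 1) = theta4 τ := by
  refine tsum_congr fun n ↦ ?_
  simp only [jacobiTheta₂_term]
  refine exp_eq_exp_of_eq_add_even (Int.even_mul_pred_self n) ?_
  push_cast
  ring

lemma theta4_add_one (τ : ℂ) : theta4 (τ + 1) = theta3 τ := by
  refine tsum_congr fun n ↦ ?_
  simp only [jacobiTheta₂_term]
  refine exp_eq_exp_of_eq_add_even (Int.even_mul_succ_self n) ?_
  push_cast
  ring

lemma theta2_add_one (τ : ℂ) : theta2 (τ + 1) = cexp (π * I / 4) * theta2 τ := by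
  have : jacobiTheta₂ ((τ + 1) / 2) (τ + 1) = jacobiTheta₂ (τ / 2) τ := by
    refine tsum_congr fun n ↦ ?_
    simp only [jacobiTheta₂_term]
    refine exp_eq_exp_of_eq_add_even (Int.even_mul_succ_self n) ?_
    push_cast
    ring
  rw [theta2, theta2, this, ← mul_assoc, ← Complex.exp_add]
  ring_nf

/-- The automorphy factor `√(-iτ)` of weight one half. -/
def halfFactor (τ : ℂ) : ℂ := (-I * τ) ^ (1 / 2 : ℂ)

lemma halfFactor_sq (τ : ℂ) : halfFactor τ ^ 2 = -I * τ := by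
  rw [halfFactor, ← cpow_nat_mul]
  norm_num

lemma halfFactor_ne_zero {τ : ℂ} (hτ : τ ≠ 0) : halfFactor τ ≠ 0 := fun h ↦ by
  have := halfFactor_sq τ
  simp [h, hτ] at this

lemma theta3_neg_inv {τ : ℂ} (hτ : τ ≠ 0) : theta3 (-1 / τ) = halfFactor τ * theta3 τ := by
  have h := jacobiTheta₂_functional_equation 0 τ
  have h0 := halfFactor_ne_zero hτ
  rw [halfFactor] at h0
  simp only [theta3, halfFactor, h]
  simp
  field_simp

lemma theta4_neg_inv {τ : ℂ} (hτ : τ ≠ 0) : theta4 (-1 / τ) = halfFactor τ * theta2 τ := by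
  have h := jacobiTheta₂_functional_equation (τ / 2) τ
  have h0 := halfFactor_ne_zero hτ
  rw [halfFactor] at h0
  simp only [theta4, theta2, halfFactor, h]
  rw [show τ / 2 / τ = 1 / 2 by field_simp,
    show -π * I * (τ / 2) ^ 2 / τ = -(π * I * τ / 4) by field_simp; norm_num, Complex.exp_neg]
  have := Complex.exp_ne_zero (π * I * τ / 4)
  field_simp

lemma theta2_neg_inv {τ : ℂ} (hτ : τ ≠ 0) : theta2 (-1 / τ) = halfFactor τ * theta4 τ := by
  have h := jacobiTheta₂_functional_equation (1 / 2) τ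
  have h0 := halfFactor_ne_zero hτ
  rw [halfFactor] at h0
  simp only [theta4, theta2, halfFactor, h]
  rw [show -1 / τ / 2 = -(1 / 2 / τ) by field_simp, jacobiTheta₂_neg_left,
    show -π * I * (1 / 2) ^ 2 / τ = (π * I * (-1 / τ) / 4) by field_simp; norm_num]
  field_simp

lemma differentiableOn_theta3 : DifferentiableOn ℂ theta3 upperHalfPlaneSet := fun _ hτ ↦
  (differentiableAt_jacobiTheta₂_snd 0 hτ).differentiableWithinAt

lemma differentiableOn_theta4 : DifferentiableOn ℂ theta4 upperHalfPlaneSet := fun _ hτ ↦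
  (differentiableAt_jacobiTheta₂_snd (1 / 2) hτ).differentiableWithinAt

lemma differentiableOn_theta2 : DifferentiableOn ℂ theta2 upperHalfPlaneSet := by
  intro τ hτ
  refine DifferentiableAt.differentiableWithinAt (DifferentiableAt.mul (by fun_prop) ?_)
  exact (hasFDerivAt_jacobiTheta₂ (τ / 2) hτ).differentiableAt.comp τ
    (f := fun τ : ℂ ↦ (τ / 2, τ)) (by fun_prop)

/-- The theta series `∑_{n ∈ ℤ} q^{n²}`. -/
def phi (q : ℂ) : ℂ := ∑' n : ℤ, q ^ (n ^ 2)

/-- The theta series `∑_{n ∈ ℤ} q^{n² + n}`. -/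
def psi (q : ℂ) : ℂ := ∑' n : ℤ, q ^ (n ^ 2 + n)

/-- The nome `e^{π i τ}`. -/
def nome (τ : ℂ) : ℂ := cexp (π * I * τ)

lemma theta3_eq_phi (τ : ℂ) : theta3 τ = phi (nome τ) := by
  refine tsum_congr fun n ↦ ?_
  rw [nome, ← Complex.exp_int_mul, jacobiTheta₂_term]
  congr 1
  push_cast
  ring

lemma theta4_eq_phi (τ : ℂ) : theta4 τ = phi (-nome τ) := by
  have : -nome τ = nome (τ + 1) := by
    simp [nome, mul_add, Complex.exp_add]
  rw [this, ← theta3_eq_phi, theta3_add_one]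

lemma theta2_eq_psi (τ : ℂ) : theta2 τ = cexp (π * I * τ / 4) * psi (nome τ) := by
  rw [theta2]
  congr 1
  refine tsum_congr fun n ↦ ?_
  rw [nome, ← Complex.exp_int_mul, jacobiTheta₂_term]
  congr 1
  push_cast
  ring

lemma norm_nome (τ : ℂ) : ‖nome τ‖ = Real.exp (-π * τ.im) := by
  rw [nome, Complex.norm_exp]
  simp

lemma norm_nome_lt_one {τ : ℂ} (hτ : 0 < τ.im) : ‖nome τ‖ < 1 := by
  rw [norm_nome, Real.exp_lt_one_iff]
  have := mul_pos Real.pi_pos hτ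
  linarith

lemma exists_nome_eq {q : ℂ} (h0 : q ≠ 0) (h1 : ‖q‖ < 1) : ∃ τ : ℂ, 0 < τ.im ∧ nome τ = q := by
  have hπ : (π : ℂ) ≠ 0 := by exact_mod_cast Real.pi_ne_zero
  have h : nome (log q / (π * I)) = q := by
    rw [nome, mul_div_cancel₀ _ (mul_ne_zero hπ I_ne_zero), exp_log h0]
  refine ⟨_, ?_, h⟩
  rw [← h, norm_nome, Real.exp_lt_one_iff] at h1
  nlinarith [Real.pi_pos]

lemma tendsto_nome : Tendsto nome (comap Complex.im atTop) (𝓝 0) := by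
  rw [tendsto_zero_iff_norm_tendsto_zero]
  simp_rw [norm_nome]
  refine Real.tendsto_exp_atBot.comp ?_
  exact tendsto_comap.const_mul_atTop_of_neg (by linarith [Real.pi_pos])

lemma isBigO_exp_of_isBigO_nome_pow {f : ℂ → ℂ} (n : ℕ)
    (hf : f =O[comap Complex.im atTop] fun τ ↦ nome τ ^ n) :
    f =O[comap Complex.im atTop] fun τ ↦ Real.exp (-(n * π) * τ.im) := by
  refine hf.trans (IsBigO.of_norm_eventuallyLE (Eventually.of_forall fun τ ↦ ?_))
  simp only [norm_pow, norm_nome]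
  rw [← Real.exp_nat_mul]
  apply le_of_eq
  congr 1
  ring

lemma eqOn_zero_or_eqOn_zero_of_mul {f g : ℂ → ℂ} (hf : DifferentiableOn ℂ f upperHalfPlaneSet)
    (hg : DifferentiableOn ℂ g upperHalfPlaneSet) (h : ∀ τ : ℂ, 0 < τ.im → f τ * g τ = 0) :
    (∀ τ : ℂ, 0 < τ.im → f τ = 0) ∨ ∀ τ : ℂ, 0 < τ.im → g τ = 0 :=
  AnalyticOnNhd.eq_zero_or_eq_zero_of_mul_eq_zero (hf.analyticOnNhd isOpen_upperHalfPlaneSet)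
    (hg.analyticOnNhd isOpen_upperHalfPlaneSet) h
    (convex_halfSpace_im_gt 0).isPreconnected

end Theta

section Eisenstein

open Complex Filter Topology Asymptotics ModularForm
open UpperHalfPlane hiding I
open scoped Real MatrixGroups

/-- The Lambert series `∑_{j ≥ 1} j³ q^j / (1 - q^j)`. -/
def lambert (q : ℂ) : ℂ := ∑' j : ℕ, ((j : ℂ) + 1) ^ 3 * q ^ (j + 1) / (1 - q ^ (j + 1))

lemma summable_lambert {q : ℂ} (hq : ‖q‖ < 1) :
    Summable fun j : ℕ ↦ ((j : ℂ) + 1) ^ 3 * q ^ (j + 1) / (1 - q ^ (j + 1)) := by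
  refine ((summable_nat_add_iff 1).mpr
    (summable_norm_pow_mul_geometric_div_one_sub (𝕜 := ℂ) 3 hq)).congr fun j ↦ ?_
  push_cast
  rfl

/-- The Eisenstein series of weight four as a function on `ℂ`. -/
def eis4 (τ : ℂ) : ℂ := E₄ (ofComplex τ)

lemma eis4_eq_lambert {τ : ℂ} (hτ : 0 < τ.im) :
    eis4 τ = 1 + 240 * lambert (nome (2 * τ)) := by
  have hn : nome (2 * τ) = cexp (2 * π * I * τ) := by rw [nome]; ring_nf
  have h1 : ‖nome (2 * τ)‖ < 1 := norm_nome_lt_one (by simpa using hτ)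
  have hb : bernoulli 4 = -1 / 30 := by decide +kernel
  rw [eis4, ofComplex_apply_of_im_pos hτ,
    EisensteinSeries.q_expansion_bernoulli (by norm_num) (by decide), hb]
  simp_rw [zpow_natCast]
  rw [← hn, ← tsum_pow_div_one_sub_eq_tsum_sigma h1 3, lambert,
    tsum_pnat_eq_tsum_succ (f := fun n : ℕ ↦ (n : ℂ) ^ 3 * nome (2 * τ) ^ n / (1 - nome (2 * τ) ^ n))]
  push_cast
  ring

lemma eis4_add_one {τ : ℂ} (hτ : 0 < τ.im) : eis4 (τ + 1) = eis4 τ := by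
  have h : nome (2 * (τ + 1)) = nome (2 * τ) := by
    rw [nome, nome]
    exact exp_eq_exp_of_eq_add_even (m := 2) (by decide) (by push_cast; ring)
  rw [eis4_eq_lambert hτ, eis4_eq_lambert (by simpa using hτ), h]

lemma im_neg_one_div_pos {τ : ℂ} (hτ : 0 < τ.im) : 0 < (-1 / τ).im := by
  have := (UpperHalfPlane.mk τ hτ).im_inv_neg_coe_pos
  simpa [neg_div] using this

lemma eis4_neg_inv {τ : ℂ} (hτ : 0 < τ.im) : eis4 (-1 / τ) = τ ^ 4 * eis4 τ := by
  have h := E₄.slash_action_eq' _ ⟨ModularGroup.S, rfl⟩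
  have h' : (E₄ : ℍ → ℂ) ∣[(4 : ℤ)] ModularGroup.S = E₄ := h
  have := congrFun h' ⟨τ, hτ⟩
  rw [SlashInvariantForm.slash_S_apply] at this
  have hτ0 : τ ≠ 0 := fun h ↦ by simp [h] at hτ
  rw [eis4, eis4, ofComplex_apply_of_im_pos hτ, ofComplex_apply_of_im_pos (im_neg_one_div_pos hτ),
    ← this]
  have e : (⟨-1 / τ, im_neg_one_div_pos hτ⟩ : ℍ) =
      ⟨(-((⟨τ, hτ⟩ : ℍ) : ℂ))⁻¹, im_inv_neg_coe_pos ⟨τ, hτ⟩⟩ := by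
    ext
    simp [neg_div]
  have h4 : τ ^ 4 * τ ^ (-4 : ℤ) = 1 := by
    rw [zpow_neg, zpow_ofNat, mul_inv_cancel₀ (pow_ne_zero 4 hτ0)]
  rw [e, mul_left_comm]
  exact (mul_one _).symm.trans (congrArg _ h4.symm)

lemma differentiableOn_eis4 : DifferentiableOn ℂ eis4 upperHalfPlaneSet :=
  UpperHalfPlane.mdifferentiable_iff.mp E₄.holo'

end Eisenstein

section Jets

open Complex Filter Topology Asymptotics
open scoped Real

/-- `f(q) = a + b q + O(q²)` as `q → 0`. -/
def HasJet (f : ℂ → ℂ) (a b : ℂ) : Prop :=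
  (fun q ↦ f q - (a + b * q)) =O[𝓝 0] fun q ↦ q ^ 2

namespace HasJet

variable {f g : ℂ → ℂ} {a b a' b' : ℂ}

lemma const (a : ℂ) : HasJet (fun _ ↦ a) a 0 := by
  simpa [HasJet] using isBigO_zero _ _

lemma id : HasJet (fun q ↦ q) 0 1 := by
  simpa [HasJet] using isBigO_zero _ _

lemma congr (hf : HasJet f a b) (ha : a = a') (hb : b = b') : HasJet f a' b' :=
  ha ▸ hb ▸ hf

lemma add (hf : HasJet f a b) (hg : HasJet g a' b') :
    HasJet (fun q ↦ f q + g q) (a + a') (b + b') :=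
  (IsBigO.add hf hg).congr_left fun q ↦ by ring

lemma sub (hf : HasJet f a b) (hg : HasJet g a' b') :
    HasJet (fun q ↦ f q - g q) (a - a') (b - b') :=
  (IsBigO.sub hf hg).congr_left fun q ↦ by ring

lemma isBigO_one (hf : HasJet f a b) : f =O[𝓝 0] fun _ ↦ (1 : ℂ) := by
  have h1 : (fun q : ℂ ↦ q ^ 2) =O[𝓝 0] fun _ ↦ (1 : ℂ) :=
    Tendsto.isBigO_one ℂ (Continuous.tendsto (by fun_prop) 0) 
  have h2 : (fun q : ℂ ↦ a + b * q) =O[𝓝 0] fun _ ↦ (1 : ℂ) :=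
    Tendsto.isBigO_one ℂ (Continuous.tendsto (by fun_prop) 0)
  exact ((IsBigO.trans hf h1).add h2).congr_left fun q ↦ by ring

lemma mul (hf : HasJet f a b) (hg : HasJet g a' b') :
    HasJet (fun q ↦ f q * g q) (a * a') (a * b' + b * a') := by
  have h1 := IsBigO.mul hf hg.isBigO_one
  have h2 : (fun q : ℂ ↦ a + b * q) =O[𝓝 0] fun _ ↦ (1 : ℂ) :=
    Tendsto.isBigO_one ℂ (Continuous.tendsto (by fun_prop) 0)
  have h3 := IsBigO.mul h2 hg
  have h4 : (fun q : ℂ ↦ b * b' * q ^ 2) =O[𝓝 0] fun q : ℂ ↦ q ^ 2 :=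
    (isBigO_refl _ _).const_mul_left _
  simp only [mul_one, one_mul] at h1 h3
  exact ((h1.add h3).add h4).congr_left fun q ↦ by ring

lemma pow (hf : HasJet f a b) (n : ℕ) :
    HasJet (fun q ↦ f q ^ (n + 1)) (a ^ (n + 1)) ((n + 1) * a ^ n * b) := by
  induction n with
  | zero => simpa using hf
  | succ n ih =>
    simp_rw [pow_succ _ (n + 1)]
    exact (ih.mul hf).congr rfl (by push_cast; ring)

lemma const_mul (hf : HasJet f a b) (c : ℂ) : HasJet (fun q ↦ c * f q) (c * a) (c * b) :=
  ((HasJet.const c).mul hf).congr rfl (by ring)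

lemma comp_neg (hf : HasJet f a b) : HasJet (fun q ↦ f (-q)) a (-b) := by
  have : Tendsto (fun q : ℂ ↦ -q) (𝓝 0) (𝓝 0) := by
    simpa using (continuous_neg (G := ℂ)).tendsto 0
  exact (hf.comp_tendsto this).congr (fun q ↦ by simp) (fun q ↦ by simp)

lemma comp_pow (hf : HasJet f a b) (k : ℕ) : HasJet (fun q ↦ f (q ^ (k + 2))) a 0 := by
  have : Tendsto (fun q : ℂ ↦ q ^ (k + 2)) (𝓝 0) (𝓝 0) := by
    simpa using (continuous_pow (M := ℂ) (k + 2)).tendsto 0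
  have h1 := hf.comp_tendsto this
  have h2 : (fun q : ℂ ↦ q ^ k) =O[𝓝 0] fun _ ↦ (1 : ℂ) :=
    Tendsto.isBigO_one ℂ (Continuous.tendsto (by fun_prop) 0)
  have h3 : (fun q : ℂ ↦ q ^ (k + 2)) =O[𝓝 0] fun q : ℂ ↦ q ^ 2 := by
    simpa [pow_add] using h2.mul (isBigO_refl (fun q : ℂ ↦ q ^ 2) _)
  have h4 : (fun q : ℂ ↦ q ^ (k + 2)) =O[𝓝 0] fun _ ↦ (1 : ℂ) :=
    Tendsto.isBigO_one ℂ (Continuous.tendsto (by fun_prop) 0)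
  have h5 : (fun q : ℂ ↦ (q ^ (k + 2)) ^ 2) =O[𝓝 0] fun q : ℂ ↦ q ^ 2 := by
    simpa [sq] using h4.mul h3
  exact ((IsBigO.trans h1 h5).add (h3.const_mul_left b)).congr_left fun q ↦ by
    simp only [Function.comp_apply]; ring

lemma isBigO_sq (hf : HasJet f 0 0) : f =O[𝓝 0] fun q ↦ q ^ 2 := by
  simpa [HasJet] using hf

lemma isBigO_id (hf : HasJet f 0 b) : f =O[𝓝 0] fun q ↦ q := by
  have h2 : (fun q : ℂ ↦ q) =O[𝓝 0] fun _ ↦ (1 : ℂ) :=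
    Tendsto.isBigO_one ℂ (Continuous.tendsto (by fun_prop) 0)
  have h3 : (fun q : ℂ ↦ q ^ 2) =O[𝓝 0] fun q : ℂ ↦ q := by
    simpa [sq] using h2.mul (isBigO_refl (fun q : ℂ ↦ q) _)
  exact ((IsBigO.trans hf h3).add ((isBigO_refl (fun q : ℂ ↦ q) _).const_mul_left b)).congr_left
    fun q ↦ by ring

lemma of_eq_add_sq_mul {h : ℂ → ℂ} {C : ℝ} 
    (hf : ∀ q : ℂ, ‖q‖ ≤ 1 / 2 → f q = a + b * q + q ^ 2 * h q ∧ ‖h q‖ ≤ C) : HasJet f a b := by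
  refine IsBigO.of_bound C ?_
  filter_upwards [Metric.closedBall_mem_nhds (0 : ℂ) (by norm_num : (0 : ℝ) < 1 / 2)] with q hq
  obtain ⟨h1, h2⟩ := hf q (by simpa using hq)
  rw [h1, show a + b * q + q ^ 2 * h q - (a + b * q) = h q * q ^ 2 by ring, norm_mul]
  gcongr

end HasJet

lemma summable_pow_of_le {q : ℂ} (hq : ‖q‖ < 1) {e : ℕ → ℕ} (he : ∀ n, n ≤ e n) :
    Summable fun n ↦ q ^ e n :=
  .of_norm_bounded (summable_geometric_of_lt_one (norm_nonneg q) hq) fun n ↦ by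
    rw [norm_pow]
    exact pow_le_pow_of_le_one (norm_nonneg q) hq.le (he n)

lemma norm_tsum_pow_le {q : ℂ} (hq : ‖q‖ ≤ 1 / 2) {e : ℕ → ℕ} (he : ∀ n, n ≤ e n) :
    ‖∑' n, q ^ e n‖ ≤ 2 := by
  refine tsum_of_norm_bounded hasSum_geometric_two fun n ↦ ?_
  rw [norm_pow]
  exact (pow_le_pow_of_le_one (norm_nonneg q) (by linarith) (he n)).trans (by gcongr)

lemma hasSum_pow_sq {q : ℂ} (hq : ‖q‖ < 1) : HasSum (fun n : ℤ ↦ q ^ (n ^ 2))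
    (∑' n : ℕ, q ^ (n ^ 2) + ∑' n : ℕ, q ^ ((n + 1) ^ 2)) := by
  have h1 := summable_pow_of_le hq (e := fun n ↦ n ^ 2) fun n ↦ by nlinarith
  have h2 := summable_pow_of_le hq (e := fun n ↦ (n + 1) ^ 2) fun n ↦ by nlinarith
  have h : ∀ m : ℕ, q ^ ((m : ℤ) ^ 2) = q ^ (m ^ 2) := fun m ↦ by
    rw [← zpow_natCast]; push_cast; rfl
  have h' : ∀ m : ℕ, q ^ ((-((m : ℤ) + 1)) ^ 2) = q ^ ((m + 1) ^ 2) := fun m ↦ by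
    rw [← zpow_natCast, neg_sq]; push_cast; rfl
  refine HasSum.of_nat_of_neg_add_one (f := fun n : ℤ ↦ q ^ (n ^ 2)) ?_ ?_
  · simpa only [h] using h1.hasSum
  · simpa only [h'] using h2.hasSum

lemma phi_eq_tsum_nat {q : ℂ} (hq : ‖q‖ < 1) :
    phi q = ∑' n : ℕ, q ^ (n ^ 2) + ∑' n : ℕ, q ^ ((n + 1) ^ 2) :=
  (hasSum_pow_sq hq).tsum_eq

lemma hasSum_pow_sq_add {q : ℂ} (hq : ‖q‖ < 1) : HasSum (fun n : ℤ ↦ q ^ (n ^ 2 + n))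
    (2 * ∑' n : ℕ, q ^ (n ^ 2 + n)) := by
  have h1 := summable_pow_of_le hq (e := fun n ↦ n ^ 2 + n) fun n ↦ by nlinarith
  have h : ∀ m : ℕ, q ^ ((m : ℤ) ^ 2 + m) = q ^ (m ^ 2 + m) := fun m ↦ by
    rw [← zpow_natCast]; push_cast; rfl
  have h' : ∀ m : ℕ, q ^ ((-((m : ℤ) + 1)) ^ 2 + -((m : ℤ) + 1)) = q ^ (m ^ 2 + m) := fun m ↦ by
    rw [← zpow_natCast]; push_cast; ring_nf
  rw [two_mul]
  refine HasSum.of_nat_of_neg_add_one (f := fun n : ℤ ↦ q ^ (n ^ 2 + n)) ?_ ?_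
  · simpa only [h] using h1.hasSum
  · simpa only [h'] using h1.hasSum

lemma psi_eq_tsum_nat {q : ℂ} (hq : ‖q‖ < 1) :
    psi q = 2 * ∑' n : ℕ, q ^ (n ^ 2 + n) :=
  (hasSum_pow_sq_add hq).tsum_eq

lemma hasJet_phi : HasJet phi 1 2 := by
  refine HasJet.of_eq_add_sq_mul (h := fun q ↦ 2 * ∑' n : ℕ, q ^ (n ^ 2 + 4 * n + 2)) (C := 4)
    fun q hq ↦ ⟨?_, ?_⟩
  · have hq' : ‖q‖ < 1 := by linarith
    rw [phi_eq_tsum_nat hq',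
      (summable_pow_of_le hq' (e := fun n ↦ n ^ 2) fun n ↦ by nlinarith).tsum_eq_zero_add,
      (summable_pow_of_le hq' (e := fun n ↦ (n + 1) ^ 2) fun n ↦ by nlinarith).tsum_eq_zero_add,
      mul_left_comm, ← tsum_mul_left]
    have : ∀ n : ℕ, q ^ ((n + 1 + 1) ^ 2) = q ^ 2 * q ^ (n ^ 2 + 4 * n + 2) := fun n ↦ by
      rw [← pow_add]; congr 1; ring
    simp_rw [this]
    simp
    ring
  · rw [norm_mul]
    have := norm_tsum_pow_le hq (e := fun n ↦ n ^ 2 + 4 * n + 2) fun n ↦ by nlinarith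
    norm_num
    linarith

lemma hasJet_psi : HasJet psi 2 0 := by
  refine HasJet.of_eq_add_sq_mul (h := fun q ↦ 2 * ∑' n : ℕ, q ^ (n ^ 2 + 3 * n)) (C := 4)
    fun q hq ↦ ⟨?_, ?_⟩
  · have hq' : ‖q‖ < 1 := by linarith
    rw [psi_eq_tsum_nat hq',
      (summable_pow_of_le hq' (e := fun n ↦ n ^ 2 + n) fun n ↦ by nlinarith).tsum_eq_zero_add,
      mul_left_comm, ← tsum_mul_left]
    have : ∀ n : ℕ, q ^ ((n + 1) ^ 2 + (n + 1)) = q ^ 2 * q ^ (n ^ 2 + 3 * n) := fun n ↦ by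
      rw [← pow_add]; congr 1; ring
    simp_rw [this]
    simp
    ring
  · rw [norm_mul]
    have := norm_tsum_pow_le hq (e := fun n ↦ n ^ 2 + 3 * n) fun n ↦ by nlinarith
    norm_num
    linarith

lemma half_le_norm_one_sub {q : ℂ} (hq : ‖q‖ ≤ 1 / 2) : 1 / 2 ≤ ‖1 - q‖ := by
  have := norm_sub_norm_le (1 : ℂ) q
  simp at this
  linarith

lemma hasJet_lambert : HasJet lambert 0 1 := by
  have hs : Summable fun n : ℕ ↦ ((n : ℝ) + 2) ^ 3 * (1 / 2 : ℝ) ^ (n + 2) := by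
    refine ((summable_nat_add_iff 2).mpr
      (summable_pow_mul_geometric_of_norm_lt_one 3 (r := (1 / 2 : ℝ)) (by norm_num))).congr
      fun n ↦ ?_
    push_cast
    rfl
  refine HasJet.of_eq_add_sq_mul (h := fun q ↦ 1 / (1 - q) +
    ∑' n : ℕ, ((n : ℂ) + 2) ^ 3 * q ^ n / (1 - q ^ (n + 2)))
    (C := 2 + ∑' n : ℕ, 8 * (((n : ℝ) + 2) ^ 3 * (1 / 2 : ℝ) ^ (n + 2))) fun q hq ↦ ⟨?_, ?_⟩
  · have hq' : ‖q‖ < 1 := by linarith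
    have h1 : 1 - q ≠ 0 := by
      rw [← norm_pos_iff]
      linarith [half_le_norm_one_sub hq]
    rw [lambert, (summable_lambert hq').tsum_eq_zero_add, mul_add, ← tsum_mul_left, ← add_assoc]
    congr 1
    · push_cast
      field_simp
      ring
    · refine tsum_congr fun n ↦ ?_
      push_cast
      ring
  · refine (norm_add_le _ _).trans (add_le_add ?_ (tsum_of_norm_bounded (hs.mul_left 8).hasSum ?_))
    · rw [norm_div, norm_one, div_le_iff₀] <;> linarith [half_le_norm_one_sub hq]
    · intro n
      have h2 : ‖q ^ (n + 2)‖ ≤ 1 / 2 := by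
        rw [norm_pow]
        exact (pow_le_of_le_one (norm_nonneg q) (by linarith) (by lia)).trans hq
      have h3 := half_le_norm_one_sub h2
      rw [norm_div, norm_mul, norm_pow, norm_pow, div_le_iff₀ (by linarith)]
      have h4 : ‖(n : ℂ) + 2‖ = n + 2 := by
        rw [show (n : ℂ) + 2 = ((n + 2 : ℕ) : ℂ) by push_cast; rfl, Complex.norm_natCast]
        push_cast
        rfl
      have h5 : ‖q‖ ^ n ≤ (1 / 2 : ℝ) ^ n := by gcongr
      rw [h4]
      calc ((n : ℝ) + 2) ^ 3 * ‖q‖ ^ n ≤ ((n : ℝ) + 2) ^ 3 * (1 / 2 : ℝ) ^ n := by gcongr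
        _ = 8 * (((n : ℝ) + 2) ^ 3 * (1 / 2 : ℝ) ^ (n + 2)) * (1 / 2) := by ring
        _ ≤ _ := by gcongr

end Jets

section SumsOfEightSquares

open Complex Filter Topology Asymptotics
open UpperHalfPlane hiding I
open scoped Real

lemma ne_zero_of_im_pos {τ : ℂ} (hτ : 0 < τ.im) : τ ≠ 0 := fun h ↦ by simp [h] at hτ

lemma halfFactor_pow_eight (τ : ℂ) : halfFactor τ ^ 8 = τ ^ 4 := by
  rw [show halfFactor τ ^ 8 = (halfFactor τ ^ 2) ^ 4 by ring, halfFactor_sq, mul_pow,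
    show (-I) ^ 4 = 1 by rw [(by decide : Even 4).neg_pow, I_pow_four], one_mul]

lemma differentiableOn_eis4_comp {f : ℂ → ℂ} (hf : Differentiable ℂ f)
    (h : ∀ τ : ℂ, 0 < τ.im → 0 < (f τ).im) :
    DifferentiableOn ℂ (fun τ ↦ eis4 (f τ)) upperHalfPlaneSet :=
  differentiableOn_eis4.comp hf.differentiableOn fun τ hτ ↦ h τ hτ

lemma eis4_half_neg_inv {τ : ℂ} (hτ : 0 < τ.im) :
    eis4 (-1 / τ / 2) = τ ^ 4 * (16 * eis4 (2 * τ)) := by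
  have h := eis4_neg_inv (τ := 2 * τ) (by simpa using hτ)
  have h0 := ne_zero_of_im_pos hτ
  rw [show -1 / τ / 2 = -1 / (2 * τ) by field_simp, h]
  ring

lemma eis4_double_neg_inv {τ : ℂ} (hτ : 0 < τ.im) :
    16 * eis4 (2 * (-1 / τ)) = τ ^ 4 * eis4 (τ / 2) := by
  have h := eis4_neg_inv (τ := τ / 2) (by simpa using hτ)
  have h0 := ne_zero_of_im_pos hτ
  rw [show 2 * (-1 / τ) = -1 / (τ / 2) by field_simp, h]
  ring

lemma eis4_half_add_one_neg_inv {τ : ℂ} (hτ : 0 < τ.im) :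
    eis4 ((-1 / τ + 1) / 2) = τ ^ 4 * eis4 ((τ + 1) / 2) := by
  have hu : 0 < ((-1 / τ + 1) / 2).im := by simpa using im_neg_one_div_pos hτ
  have hw : 0 < ((τ - 1) / 2).im := by simpa using hτ
  have h0 := ne_zero_of_im_pos hτ
  have h1 : τ - 1 ≠ 0 := ne_zero_of_im_pos (by simpa using hτ)
  have hx : 0 < (-1 / ((τ - 1) / 2) - 2).im := by simpa using im_neg_one_div_pos hw
  have e1 := eis4_neg_inv hu
  have e2 := eis4_neg_inv hw
  have e3 := eis4_add_one hx
  have e4 := eis4_add_one (τ := -1 / ((τ - 1) / 2) - 2 + 1) (by simpa using hx)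
  have e5 := eis4_add_one hw
  have h2 : -1 / ((-1 / τ + 1) / 2) = -1 / ((τ - 1) / 2) - 2 := by
    have : -1 / τ + 1 = (τ - 1) / τ := by field_simp; ring
    rw [this]
    field_simp
    ring
  rw [show -1 / ((τ - 1) / 2) - 2 + 1 + 1 = -1 / ((τ - 1) / 2) by ring, e2, e3, ← h2, e1] at e4
  rw [show (τ - 1) / 2 + 1 = (τ + 1) / 2 by ring] at e5
  have h3 : (-1 / τ + 1) / 2 = (τ - 1) / 2 / τ := by field_simp; ring
  have h4 : ((τ - 1) / 2 / τ) ^ 4 ≠ 0 :=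
    pow_ne_zero 4 (div_ne_zero (div_ne_zero h1 two_ne_zero) h0)
  rw [e5]
  rw [h3] at e4 ⊢
  rw [← mul_right_inj' h4, ← e4]
  field_simp

/-- The weight four form `15 θ₃⁸ - (E₄(τ/2) - 2 E₄(τ) + 16 E₄(2 τ))`. -/
def octic3 (τ : ℂ) : ℂ := 15 * theta3 τ ^ 8 - eis4 (τ / 2) + 2 * eis4 τ - 16 * eis4 (2 * τ)

/-- The image of `octic3` under `τ ↦ τ + 1`. -/
def octic4 (τ : ℂ) : ℂ := 15 * theta4 τ ^ 8 - eis4 ((τ + 1) / 2) + 2 * eis4 τ - 16 * eis4 (2 * τ)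

/-- The image of `octic4` under `τ ↦ -1 / τ`. -/
def octic2 (τ : ℂ) : ℂ := 15 * theta2 τ ^ 8 - eis4 ((τ + 1) / 2) + 2 * eis4 τ - eis4 (τ / 2)

lemma eis4_half_add_two {τ : ℂ} (hτ : 0 < τ.im) : eis4 ((τ + 1 + 1) / 2) = eis4 (τ / 2) := by
  rw [show (τ + 1 + 1) / 2 = τ / 2 + 1 by ring, eis4_add_one (by simpa using hτ)]

lemma eis4_double_add_one {τ : ℂ} (hτ : 0 < τ.im) : eis4 (2 * (τ + 1)) = eis4 (2 * τ) := by
  rw [show 2 * (τ + 1) = 2 * τ + 1 + 1 by ring, eis4_add_one (by simpa using hτ),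
    eis4_add_one (by simpa using hτ)]

lemma octic3_add_one {τ : ℂ} (hτ : 0 < τ.im) : octic3 (τ + 1) = octic4 τ := by
  rw [octic3, octic4, theta3_add_one, eis4_add_one hτ, eis4_double_add_one hτ]

lemma octic4_add_one {τ : ℂ} (hτ : 0 < τ.im) : octic4 (τ + 1) = octic3 τ := by
  rw [octic3, octic4, theta4_add_one, eis4_add_one hτ, eis4_double_add_one hτ, eis4_half_add_two hτ]

lemma octic2_add_one {τ : ℂ} (hτ : 0 < τ.im) : octic2 (τ + 1) = octic2 τ := by
  have : cexp (π * I / 4) ^ 8 = 1 := by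
    rw [← Complex.exp_nat_mul, ← Complex.exp_two_pi_mul_I]
    congr 1
    push_cast
    ring
  rw [octic2, octic2, theta2_add_one, eis4_add_one hτ, eis4_half_add_two hτ, mul_pow, this]
  ring

lemma octic3_neg_inv {τ : ℂ} (hτ : 0 < τ.im) : octic3 (-1 / τ) = τ ^ 4 * octic3 τ := by
  rw [octic3, octic3, theta3_neg_inv (ne_zero_of_im_pos hτ), eis4_neg_inv hτ,
    eis4_half_neg_inv hτ, eis4_double_neg_inv hτ, mul_pow, halfFactor_pow_eight]
  ring

lemma octic4_neg_inv {τ : ℂ} (hτ : 0 < τ.im) : octic4 (-1 / τ) = τ ^ 4 * octic2 τ := by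
  rw [octic4, octic2, theta4_neg_inv (ne_zero_of_im_pos hτ), eis4_neg_inv hτ,
    eis4_half_add_one_neg_inv hτ, eis4_double_neg_inv hτ, mul_pow, halfFactor_pow_eight]
  ring

lemma octic2_neg_inv {τ : ℂ} (hτ : 0 < τ.im) : octic2 (-1 / τ) = τ ^ 4 * octic4 τ := by
  rw [octic4, octic2, theta2_neg_inv (ne_zero_of_im_pos hτ), eis4_neg_inv hτ,
    eis4_half_add_one_neg_inv hτ, eis4_half_neg_inv hτ, mul_pow, halfFactor_pow_eight]
  ring

lemma differentiableOn_octic3 : DifferentiableOn ℂ octic3 upperHalfPlaneSet :=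
  ((((differentiableOn_theta3.pow 8).const_mul 15).sub (differentiableOn_eis4_comp
    (f := fun τ ↦ τ / 2) (by fun_prop) (by simp))).add (differentiableOn_eis4.const_mul 2)).sub
    ((differentiableOn_eis4_comp (f := fun τ ↦ 2 * τ) (by fun_prop) (by simp)).const_mul 16)

lemma differentiableOn_octic4 : DifferentiableOn ℂ octic4 upperHalfPlaneSet :=
  ((((differentiableOn_theta4.pow 8).const_mul 15).sub (differentiableOn_eis4_comp
    (f := fun τ ↦ (τ + 1) / 2) (by fun_prop) (by simp))).add
    (differentiableOn_eis4.const_mul 2)).sub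
    ((differentiableOn_eis4_comp (f := fun τ ↦ 2 * τ) (by fun_prop) (by simp)).const_mul 16)

lemma differentiableOn_octic2 : DifferentiableOn ℂ octic2 upperHalfPlaneSet :=
  ((((differentiableOn_theta2.pow 8).const_mul 15).sub (differentiableOn_eis4_comp
    (f := fun τ ↦ (τ + 1) / 2) (by fun_prop) (by simp))).add
    (differentiableOn_eis4.const_mul 2)).sub
    (differentiableOn_eis4_comp (f := fun τ ↦ τ / 2) (by fun_prop) (by simp))

lemma nome_add_one (τ : ℂ) : nome (τ + 1) = -nome τ := by
  simp [nome, mul_add, Complex.exp_add]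

lemma nome_natCast_mul (n : ℕ) (τ : ℂ) : nome (n * τ) = nome τ ^ n := by
  rw [nome, nome, ← Complex.exp_nat_mul]
  ring_nf

lemma eis4_half_eq {τ : ℂ} (hτ : 0 < τ.im) : eis4 (τ / 2) = 1 + 240 * lambert (nome τ) := by
  rw [eis4_eq_lambert (by simpa using hτ), show 2 * (τ / 2) = τ by ring]

lemma eis4_half_add_one_eq {τ : ℂ} (hτ : 0 < τ.im) :
    eis4 ((τ + 1) / 2) = 1 + 240 * lambert (-nome τ) := by
  rw [eis4_half_eq (by simpa using hτ), nome_add_one]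

lemma eis4_eq {τ : ℂ} (hτ : 0 < τ.im) : eis4 τ = 1 + 240 * lambert (nome τ ^ 2) := by
  rw [eis4_eq_lambert hτ, ← nome_natCast_mul]
  rfl

lemma eis4_double_eq {τ : ℂ} (hτ : 0 < τ.im) :
    eis4 (2 * τ) = 1 + 240 * lambert (nome τ ^ 4) := by
  rw [eis4_eq_lambert (by simpa using hτ), ← nome_natCast_mul]
  congr 4
  push_cast
  ring

lemma theta2_pow_eight (τ : ℂ) : theta2 τ ^ 8 = nome τ ^ 2 * psi (nome τ) ^ 8 := by
  rw [theta2_eq_psi, mul_pow, ← Complex.exp_nat_mul, nome, ← Complex.exp_nat_mul]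
  congr 2
  push_cast
  ring

lemma eventually_im_pos : ∀ᶠ τ : ℂ in comap Complex.im atTop, 0 < τ.im :=
  tendsto_comap.eventually (eventually_gt_atTop 0)

lemma HasJet.isBigO_nome {f F : ℂ → ℂ} {b : ℂ} (hf : HasJet f 0 b)
    (h : ∀ τ : ℂ, 0 < τ.im → F τ = f (nome τ)) :
    F =O[comap Complex.im atTop] nome :=
  (hf.isBigO_id.comp_tendsto tendsto_nome).congr'
    (eventually_im_pos.mono fun τ hτ ↦ (h τ hτ).symm) .rfl

lemma HasJet.isBigO_nome_sq {f F : ℂ → ℂ} (hf : HasJet f 0 0)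
    (h : ∀ τ : ℂ, 0 < τ.im → F τ = f (nome τ)) :
    F =O[comap Complex.im atTop] fun τ ↦ nome τ ^ 2 :=
  (hf.isBigO_sq.comp_tendsto tendsto_nome).congr'
    (eventually_im_pos.mono fun τ hτ ↦ (h τ hτ).symm) .rfl

lemma exists_hasJet_octic : ∃ b, HasJet (fun q ↦ 15 * phi q ^ 8 - (1 + 240 * lambert q) +
    2 * (1 + 240 * lambert (q ^ 2)) - 16 * (1 + 240 * lambert (q ^ 4))) 0 b := by
  have h := (((((hasJet_phi.pow 7).const_mul 15).sub
    ((HasJet.const 1).add (hasJet_lambert.const_mul 240))).add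
    (((HasJet.const 1).add ((hasJet_lambert.comp_pow 0).const_mul 240)).const_mul 2))).sub
    (((HasJet.const 1).add ((hasJet_lambert.comp_pow 2).const_mul 240)).const_mul 16)
  exact ⟨_, h.congr (by norm_num) rfl⟩

lemma isBigO_octic3 : octic3 =O[comap Complex.im atTop] nome := by
  obtain ⟨b, hb⟩ := exists_hasJet_octic
  refine hb.isBigO_nome fun τ hτ ↦ ?_
  rw [octic3, theta3_eq_phi, eis4_half_eq hτ, eis4_eq hτ, eis4_double_eq hτ]

lemma isBigO_octic4 : octic4 =O[comap Complex.im atTop] nome := by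
  obtain ⟨b, hb⟩ := exists_hasJet_octic
  refine hb.comp_neg.isBigO_nome fun τ hτ ↦ ?_
  rw [octic4, theta4_eq_phi, eis4_half_add_one_eq hτ, eis4_eq hτ, eis4_double_eq hτ]
  simp only [even_two.neg_pow, (by decide : Even 4).neg_pow]

lemma isBigO_octic2 : octic2 =O[comap Complex.im atTop] nome := by
  have h := ((((((HasJet.id.pow 1).mul (hasJet_psi.pow 7)).const_mul 15).sub
    ((HasJet.const 1).add (hasJet_lambert.comp_neg.const_mul 240))).add
    (((HasJet.const 1).add ((hasJet_lambert.comp_pow 0).const_mul 240)).const_mul 2))).sub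
    ((HasJet.const 1).add (hasJet_lambert.const_mul 240))
  refine (h.congr (a' := 0) (by norm_num) rfl).isBigO_nome fun τ hτ ↦ ?_
  rw [octic2, theta2_pow_eight, eis4_half_add_one_eq hτ, eis4_eq hτ, eis4_half_eq hτ]

lemma octic3_eq_zero {τ : ℂ} (hτ : 0 < τ.im) : octic3 τ = 0 := by
  have hP : ∀ τ ∈ upperHalfPlaneSet, octic2 τ * octic3 τ * octic4 τ = 0 := by
    refine levelOne_eq_zero_of_isBigO 1 (c := (3 : ℕ) * π) ?_
      ((differentiableOn_octic2.mul differentiableOn_octic3).mul differentiableOn_octic4)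
      (fun τ hτ ↦ ?_) (fun τ hτ ↦ ?_) (isBigO_exp_of_isBigO_nome_pow 3 ?_)
    · push_cast
      linarith [Real.pi_pos]
    · rw [octic2_add_one hτ, octic3_add_one hτ, octic4_add_one hτ]
      ring
    · rw [octic2_neg_inv hτ, octic3_neg_inv hτ, octic4_neg_inv hτ]
      ring
    · exact ((isBigO_octic2.mul isBigO_octic3).mul isBigO_octic4).congr_right fun τ ↦ by ring
  have h4 (h : ∀ τ : ℂ, 0 < τ.im → octic4 τ = 0) : octic3 τ = 0 := by
    rw [← octic4_add_one hτ, h _ (by simpa using hτ)]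
  rcases eqOn_zero_or_eqOn_zero_of_mul (differentiableOn_octic2.mul differentiableOn_octic3)
    differentiableOn_octic4 hP with h | h
  · rcases eqOn_zero_or_eqOn_zero_of_mul differentiableOn_octic2 differentiableOn_octic3 h
      with h | h
    · refine h4 fun τ hτ ↦ ?_
      have := octic2_neg_inv hτ
      rw [h _ (im_neg_one_div_pos hτ)] at this
      simpa [ne_zero_of_im_pos hτ] using this.symm
    · exact h τ hτ
  · exact h4 h

theorem phi_pow_eight {q : ℂ} (h0 : q ≠ 0) (hq : ‖q‖ < 1) :
    phi q ^ 8 = 1 + 16 * (lambert q - 2 * lambert (q ^ 2) + 16 * lambert (q ^ 4)) := by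
  obtain ⟨τ, hτ, rfl⟩ := exists_nome_eq h0 hq
  have := octic3_eq_zero hτ
  rw [octic3, theta3_eq_phi, eis4_half_eq hτ, eis4_eq hτ, eis4_double_eq hτ] at this
  linear_combination this / 15

end SumsOfEightSquares

section CubicIdentity

open Complex Filter Topology Asymptotics
open UpperHalfPlane hiding I
open scoped Real

section LevelThree

variable {H : ℂ → ℂ}

lemma apply_neg_inv_of_fricke (hW : ∀ τ : ℂ, 0 < τ.im → H (-1 / (3 * τ)) = 729 * τ ^ 12 * H τ)
    {τ : ℂ} (hτ : 0 < τ.im) : H (-1 / τ) = 729 * (τ / 3) ^ 12 * H (τ / 3) := by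
  rw [← hW (τ / 3) (by simpa using hτ), show 3 * (τ / 3) = τ by ring]

lemma apply_neg_inv_sub_div_three
    (hW : ∀ τ : ℂ, 0 < τ.im → H (-1 / (3 * τ)) = 729 * τ ^ 12 * H τ) {e : ℝ} (he : e ^ 2 = 1)
    (hT : ∀ τ : ℂ, 0 < τ.im → H (e + τ) = H τ) {τ : ℂ} (hτ : 0 < τ.im) :
    H ((-1 / τ - e) / 3) = τ ^ 12 * H ((τ + e) / 3) := by
  have he' : (e : ℂ) ^ 2 = 1 := by exact_mod_cast he
  have he0 : (e : ℂ) ≠ 0 := fun h ↦ by simp [h] at he'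
  have hs : 0 < (τ + e).im := by simpa using hτ
  have h0 := ne_zero_of_im_pos hτ
  have h1 := ne_zero_of_im_pos hs
  have hi := im_neg_one_div_pos hs
  have hu : (e : ℂ) + -1 / (τ + e) = e * τ / (τ + e) := by
    field_simp
    linear_combination he'
  have h2 := hW (e + -1 / (τ + e)) (by simpa using hi)
  rw [hT _ hi, apply_neg_inv_of_fricke hW hs, hu] at h2
  have h3 : -1 / (3 * (e * τ / (τ + e))) = (-1 / τ - e) / 3 := by
    field_simp
    linear_combination τ * he'
  rw [← h3, h2, div_pow, div_pow, mul_pow, show (e : ℂ) ^ 12 = (e ^ 2) ^ 6 by ring, he']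
  field_simp
  norm_num

lemma tendsto_add_div_three (c : ℝ) :
    Tendsto (fun τ : ℂ ↦ (τ + c) / 3) (comap Complex.im atTop) (comap Complex.im atTop) := by
  rw [tendsto_comap_iff]
  have : (Complex.im ∘ fun τ : ℂ ↦ (τ + c) / 3) = fun τ ↦ τ.im / 3 := by
    ext τ
    simp
  rw [this]
  exact tendsto_comap.atTop_div_const (by norm_num)

lemma nome_div_three_mul (τ : ℂ) :
    nome (τ / 3) * nome ((τ + 1) / 3) * nome ((τ + 2) / 3) = -nome τ := by
  rw [← nome_add_one, nome, nome, nome, nome, ← Complex.exp_add, ← Complex.exp_add]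
  ring_nf

lemma eq_zero_of_fricke_of_isBigO (hd : DifferentiableOn ℂ H upperHalfPlaneSet)
    (hT : ∀ τ : ℂ, 0 < τ.im → H (τ + 1) = H τ)
    (hW : ∀ τ : ℂ, 0 < τ.im → H (-1 / (3 * τ)) = 729 * τ ^ 12 * H τ)
    (hO : H =O[comap Complex.im atTop] fun τ ↦ nome τ ^ 6) :
    ∀ τ : ℂ, 0 < τ.im → H τ = 0 := by
  have hd' (c : ℝ) : DifferentiableOn ℂ (fun τ ↦ H ((τ + c) / 3)) upperHalfPlaneSet :=
    hd.comp (f := fun τ : ℂ ↦ (τ + c) / 3) (Differentiable.differentiableOn (by fun_prop))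
      fun τ hτ ↦ show 0 < ((τ + c) / 3).im by simpa using hτ
  have hO' (c : ℝ) : (fun τ ↦ H ((τ + c) / 3)) =O[comap Complex.im atTop]
      fun τ ↦ nome ((τ + c) / 3) ^ 6 := hO.comp_tendsto (tendsto_add_div_three c)
  have hT0 (τ : ℂ) (hτ : 0 < τ.im) : H (((1 : ℝ) : ℂ) + τ) = H τ := by
    rw [← hT τ hτ, add_comm, ofReal_one]
  have hT1 (τ : ℂ) (hτ : 0 < τ.im) : H (((-1 : ℝ) : ℂ) + τ) = H τ := by
    rw [← hT _ (by simpa using hτ)]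
    congr 1
    push_cast
    ring
  have hN : ∀ τ ∈ upperHalfPlaneSet, H τ * (H ((τ + (0 : ℝ)) / 3) * H ((τ + (1 : ℝ)) / 3) *
      H ((τ + (2 : ℝ)) / 3)) = 0 := by
    refine levelOne_eq_zero_of_isBigO 4 (c := (12 : ℕ) * π) ?_
      (hd.mul (((hd' 0).mul (hd' 1)).mul (hd' 2))) (fun τ hτ ↦ ?_) (fun τ hτ ↦ ?_)
      (isBigO_exp_of_isBigO_nome_pow 12 ?_)
    · push_cast
      linarith [Real.pi_pos]
    · have hτ' : 0 < τ.im := hτ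
      have h := hT (τ / 3) (by simpa using hτ)
      rw [hT τ hτ]
      push_cast
      rw [show (τ + 1 + 2) / 3 = τ / 3 + 1 by ring, h]
      ring_nf
    · have hτ' : 0 < τ.im := hτ
      have hτ0 := ne_zero_of_im_pos hτ'
      have hi := im_neg_one_div_pos hτ'
      have e1 := apply_neg_inv_of_fricke hW hτ'
      have e2 := hW τ hτ
      have e3 := apply_neg_inv_sub_div_three hW (e := -1) (by norm_num) hT1 hτ'
      have e4 := apply_neg_inv_sub_div_three hW (e := 1) (by norm_num) hT0 hτ'
      have e5 := hT ((τ + (-1 : ℝ)) / 3) (by simpa using hτ')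
      have e6 := hT ((-1 / τ - (1 : ℝ)) / 3) (by simpa using hi)
      rw [show (-1 / τ + ((0 : ℝ) : ℂ)) / 3 = -1 / (3 * τ) by push_cast; field_simp; ring,
        show (-1 / τ + ((1 : ℝ) : ℂ)) / 3 = (-1 / τ - (-1 : ℝ)) / 3 by push_cast; ring,
        show (-1 / τ + ((2 : ℝ) : ℂ)) / 3 = (-1 / τ - (1 : ℝ)) / 3 + 1 by push_cast; ring,
        e1, e2, e3, e6, e4, ← e5,
        show (τ + ((-1 : ℝ) : ℂ)) / 3 + 1 = (τ + (2 : ℝ)) / 3 by push_cast; ring,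
        show (τ + ((0 : ℝ) : ℂ)) / 3 = τ / 3 by simp]
      ring
    · refine (hO.mul (((hO' 0).mul (hO' 1)).mul (hO' 2))).congr_right fun τ ↦ ?_
      push_cast
      rw [add_zero, ← mul_pow, ← mul_pow, nome_div_three_mul]
      ring
  rcases eqOn_zero_or_eqOn_zero_of_mul hd (((hd' 0).mul (hd' 1)).mul (hd' 2)) hN with h | h
  · exact h
  have key (c : ℝ) (h : ∀ τ : ℂ, 0 < τ.im → H ((τ + c) / 3) = 0) :
      ∀ τ : ℂ, 0 < τ.im → H τ = 0 := fun τ hτ ↦ by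
    have := h (3 * τ - c) (by simpa using hτ)
    rwa [show (3 * τ - c + c) / 3 = τ by ring] at this
  rcases eqOn_zero_or_eqOn_zero_of_mul ((hd' 0).mul (hd' 1)) (hd' 2) h with h | h
  · rcases eqOn_zero_or_eqOn_zero_of_mul (hd' 0) (hd' 1) h with h | h
    · exact key _ h
    · exact key _ h
  · exact key _ h

end LevelThree

/-- The product `θ₃(τ) θ₃(3 τ)`. -/
def thetaProd3 (τ : ℂ) : ℂ := theta3 τ * theta3 (3 * τ)

/-- The product `θ₄(τ) θ₄(3 τ)`. -/
def thetaProd4 (τ : ℂ) : ℂ := theta4 τ * theta4 (3 * τ)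

/-- The product `θ₂(τ) θ₂(3 τ)`. -/
def thetaProd2 (τ : ℂ) : ℂ := theta2 τ * theta2 (3 * τ)

/-- A weight four form for `Γ₀(12)` in theta constants at `τ` and `3 τ`. -/
def cubic3 (τ : ℂ) : ℂ := 10 * thetaProd3 τ ^ 4 - theta3 τ ^ 8 - 9 * theta3 (3 * τ) ^ 8 -
  16 * thetaProd3 τ ^ 2 * (thetaProd4 τ * thetaProd2 τ)

/-- The image of `cubic3` under `τ ↦ τ + 1`. -/
def cubic4 (τ : ℂ) : ℂ := 10 * thetaProd4 τ ^ 4 - theta4 τ ^ 8 - 9 * theta4 (3 * τ) ^ 8 +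
  16 * thetaProd4 τ ^ 2 * (thetaProd3 τ * thetaProd2 τ)

/-- The image of `cubic4` under `τ ↦ -1 / (3 τ)`. -/
def cubic2 (τ : ℂ) : ℂ := 10 * thetaProd2 τ ^ 4 - theta2 τ ^ 8 - 9 * theta2 (3 * τ) ^ 8 +
  16 * thetaProd2 τ ^ 2 * (thetaProd3 τ * thetaProd4 τ)

lemma theta3_three_mul_add_one (τ : ℂ) : theta3 (3 * (τ + 1)) = theta4 (3 * τ) := by
  rw [show 3 * (τ + 1) = 3 * τ + 1 + 1 + 1 by ring, theta3_add_one, theta4_add_one, theta3_add_one]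

lemma theta4_three_mul_add_one (τ : ℂ) : theta4 (3 * (τ + 1)) = theta3 (3 * τ) := by
  rw [show 3 * (τ + 1) = 3 * τ + 1 + 1 + 1 by ring, theta4_add_one, theta3_add_one, theta4_add_one]

lemma theta2_three_mul_add_one (τ : ℂ) :
    theta2 (3 * (τ + 1)) = cexp (π * I / 4) ^ 3 * theta2 (3 * τ) := by
  rw [show 3 * (τ + 1) = 3 * τ + 1 + 1 + 1 by ring, theta2_add_one, theta2_add_one, theta2_add_one]
  ring

lemma exp_pi_mul_I_div_four_pow_four : cexp (π * I / 4) ^ 4 = -1 := by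
  rw [← Complex.exp_nat_mul, ← Complex.exp_pi_mul_I]
  congr 1
  push_cast
  ring

lemma thetaProd3_add_one (τ : ℂ) : thetaProd3 (τ + 1) = thetaProd4 τ := by
  rw [thetaProd3, thetaProd4, theta3_add_one, theta3_three_mul_add_one]

lemma thetaProd4_add_one (τ : ℂ) : thetaProd4 (τ + 1) = thetaProd3 τ := by
  rw [thetaProd3, thetaProd4, theta4_add_one, theta4_three_mul_add_one]

lemma thetaProd2_add_one (τ : ℂ) : thetaProd2 (τ + 1) = -thetaProd2 τ := by
  rw [thetaProd2, thetaProd2, theta2_add_one, theta2_three_mul_add_one]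
  linear_combination theta2 τ * theta2 (3 * τ) * exp_pi_mul_I_div_four_pow_four

lemma cubic3_add_one (τ : ℂ) : cubic3 (τ + 1) = cubic4 τ := by
  rw [cubic3, cubic4, thetaProd3_add_one, thetaProd4_add_one, thetaProd2_add_one, theta3_add_one,
    theta3_three_mul_add_one]
  ring

lemma cubic4_add_one (τ : ℂ) : cubic4 (τ + 1) = cubic3 τ := by
  rw [cubic3, cubic4, thetaProd3_add_one, thetaProd4_add_one, thetaProd2_add_one, theta4_add_one,
    theta4_three_mul_add_one]
  ring

lemma cubic2_add_one (τ : ℂ) : cubic2 (τ + 1) = cubic2 τ := by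
  rw [cubic2, cubic2, thetaProd3_add_one, thetaProd4_add_one, thetaProd2_add_one, theta2_add_one,
    theta2_three_mul_add_one]
  set ζ := cexp (π * I / 4)
  have h8 : ζ ^ 8 = 1 := by
    rw [show ζ ^ 8 = (ζ ^ 4) ^ 2 by ring, exp_pi_mul_I_div_four_pow_four]
    norm_num
  rw [mul_pow, mul_pow, ← pow_mul, mul_comm 3 8, pow_mul, h8]
  ring

lemma three_mul_neg_one_div {τ : ℂ} (hτ : τ ≠ 0) : 3 * (-1 / (3 * τ)) = -1 / τ := by
  field_simp

lemma halfFactor_mul_three_pow_four (τ : ℂ) :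
    (halfFactor (3 * τ) * halfFactor τ) ^ 4 = 9 * τ ^ 4 := by
  rw [show (halfFactor (3 * τ) * halfFactor τ) ^ 4 =
    (halfFactor (3 * τ) ^ 2) ^ 2 * (halfFactor τ ^ 2) ^ 2 by ring, halfFactor_sq, halfFactor_sq]
  linear_combination 9 * τ ^ 4 * I_pow_four

lemma cubic3_fricke {τ : ℂ} (hτ : τ ≠ 0) :
    cubic3 (-1 / (3 * τ)) = 9 * τ ^ 4 * cubic3 τ := by
  have h3 : 3 * τ ≠ 0 := mul_ne_zero three_ne_zero hτ
  have e1 := halfFactor_pow_eight τ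
  have e2 := halfFactor_pow_eight (3 * τ)
  have e3 := halfFactor_mul_three_pow_four τ
  simp only [cubic3, thetaProd3, thetaProd4, thetaProd2, three_mul_neg_one_div hτ,
    theta3_neg_inv hτ, theta4_neg_inv hτ, theta2_neg_inv hτ,
    theta3_neg_inv h3, theta4_neg_inv h3, theta2_neg_inv h3]
  linear_combination (10 * (theta3 τ * theta3 (3 * τ)) ^ 4 - 16 * (theta3 τ * theta3 (3 * τ)) ^ 2 *
    (theta4 τ * theta4 (3 * τ) * (theta2 τ * theta2 (3 * τ)))) * e3 -
    theta3 (3 * τ) ^ 8 * e2 - 9 * theta3 τ ^ 8 * e1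

lemma cubic4_fricke {τ : ℂ} (hτ : τ ≠ 0) :
    cubic4 (-1 / (3 * τ)) = 9 * τ ^ 4 * cubic2 τ := by
  have h3 : 3 * τ ≠ 0 := mul_ne_zero three_ne_zero hτ
  have e1 := halfFactor_pow_eight τ
  have e2 := halfFactor_pow_eight (3 * τ)
  have e3 := halfFactor_mul_three_pow_four τ
  simp only [cubic4, cubic2, thetaProd3, thetaProd4, thetaProd2, three_mul_neg_one_div hτ,
    theta3_neg_inv hτ, theta4_neg_inv hτ, theta2_neg_inv hτ,
    theta3_neg_inv h3, theta4_neg_inv h3, theta2_neg_inv h3]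
  linear_combination (10 * (theta2 τ * theta2 (3 * τ)) ^ 4 + 16 * (theta2 τ * theta2 (3 * τ)) ^ 2 *
    (theta3 τ * theta3 (3 * τ) * (theta4 τ * theta4 (3 * τ)))) * e3 -
    theta2 (3 * τ) ^ 8 * e2 - 9 * theta2 τ ^ 8 * e1

lemma cubic2_fricke {τ : ℂ} (hτ : τ ≠ 0) :
    cubic2 (-1 / (3 * τ)) = 9 * τ ^ 4 * cubic4 τ := by
  have h3 : 3 * τ ≠ 0 := mul_ne_zero three_ne_zero hτ
  have e1 := halfFactor_pow_eight τ
  have e2 := halfFactor_pow_eight (3 * τ)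
  have e3 := halfFactor_mul_three_pow_four τ
  simp only [cubic4, cubic2, thetaProd3, thetaProd4, thetaProd2, three_mul_neg_one_div hτ,
    theta3_neg_inv hτ, theta4_neg_inv hτ, theta2_neg_inv hτ,
    theta3_neg_inv h3, theta4_neg_inv h3, theta2_neg_inv h3]
  linear_combination (10 * (theta4 τ * theta4 (3 * τ)) ^ 4 + 16 * (theta4 τ * theta4 (3 * τ)) ^ 2 *
    (theta3 τ * theta3 (3 * τ) * (theta2 τ * theta2 (3 * τ)))) * e3 -
    theta4 (3 * τ) ^ 8 * e2 - 9 * theta4 τ ^ 8 * e1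

lemma DifferentiableOn.comp_three_mul {f : ℂ → ℂ} (hf : DifferentiableOn ℂ f upperHalfPlaneSet) :
    DifferentiableOn ℂ (fun τ ↦ f (3 * τ)) upperHalfPlaneSet :=
  hf.comp (f := fun τ : ℂ ↦ 3 * τ) (Differentiable.differentiableOn (by fun_prop))
    fun τ hτ ↦ show 0 < (3 * τ).im by simpa using hτ

lemma differentiableOn_thetaProd3 : DifferentiableOn ℂ thetaProd3 upperHalfPlaneSet :=
  differentiableOn_theta3.mul differentiableOn_theta3.comp_three_mul

lemma differentiableOn_thetaProd4 : DifferentiableOn ℂ thetaProd4 upperHalfPlaneSet :=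
  differentiableOn_theta4.mul differentiableOn_theta4.comp_three_mul

lemma differentiableOn_thetaProd2 : DifferentiableOn ℂ thetaProd2 upperHalfPlaneSet :=
  differentiableOn_theta2.mul differentiableOn_theta2.comp_three_mul

lemma differentiableOn_cubic3 : DifferentiableOn ℂ cubic3 upperHalfPlaneSet :=
  ((((differentiableOn_thetaProd3.pow 4).const_mul 10).sub (differentiableOn_theta3.pow 8)).sub
    ((differentiableOn_theta3.comp_three_mul.pow 8).const_mul 9)).sub
    (((differentiableOn_thetaProd3.pow 2).const_mul 16).mul
      (differentiableOn_thetaProd4.mul differentiableOn_thetaProd2))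

lemma differentiableOn_cubic4 : DifferentiableOn ℂ cubic4 upperHalfPlaneSet :=
  ((((differentiableOn_thetaProd4.pow 4).const_mul 10).sub (differentiableOn_theta4.pow 8)).sub
    ((differentiableOn_theta4.comp_three_mul.pow 8).const_mul 9)).add
    (((differentiableOn_thetaProd4.pow 2).const_mul 16).mul
      (differentiableOn_thetaProd3.mul differentiableOn_thetaProd2))

lemma differentiableOn_cubic2 : DifferentiableOn ℂ cubic2 upperHalfPlaneSet :=
  ((((differentiableOn_thetaProd2.pow 4).const_mul 10).sub (differentiableOn_theta2.pow 8)).sub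
    ((differentiableOn_theta2.comp_three_mul.pow 8).const_mul 9)).add
    (((differentiableOn_thetaProd2.pow 2).const_mul 16).mul
      (differentiableOn_thetaProd3.mul differentiableOn_thetaProd4))

lemma nome_three_mul (τ : ℂ) : nome (3 * τ) = nome τ ^ 3 := nome_natCast_mul 3 τ

lemma thetaProd3_eq (τ : ℂ) : thetaProd3 τ = phi (nome τ) * phi (nome τ ^ 3) := by
  rw [thetaProd3, theta3_eq_phi, theta3_eq_phi, nome_three_mul]

lemma thetaProd4_eq (τ : ℂ) : thetaProd4 τ = phi (-nome τ) * phi ((-nome τ) ^ 3) := by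
  rw [thetaProd4, theta4_eq_phi, theta4_eq_phi, nome_three_mul, (by decide : Odd 3).neg_pow]

lemma thetaProd2_eq (τ : ℂ) : thetaProd2 τ = nome τ * (psi (nome τ) * psi (nome τ ^ 3)) := by
  rw [thetaProd2, theta2_eq_psi, theta2_eq_psi, nome_three_mul, mul_mul_mul_comm,
    ← Complex.exp_add]
  congr 2
  ring

lemma hasJet_phi_mul : HasJet (fun q ↦ phi q * phi (q ^ 3)) 1 2 :=
  (hasJet_phi.mul (hasJet_phi.comp_pow 1)).congr (by norm_num) (by norm_num)

lemma hasJet_mul_psi : HasJet (fun q ↦ q * (psi q * psi (q ^ 3))) 0 4 :=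
  (HasJet.id.mul (hasJet_psi.mul (hasJet_psi.comp_pow 1))).congr (by norm_num) (by norm_num)

lemma isBigO_cubic3 : cubic3 =O[comap Complex.im atTop] fun τ ↦ nome τ ^ 2 := by
  have h := ((((hasJet_phi_mul.pow 3).const_mul 10).sub (hasJet_phi.pow 7)).sub
    (((hasJet_phi.comp_pow 1).pow 7).const_mul 9)).sub
    (((hasJet_phi_mul.pow 1).const_mul 16).mul (hasJet_phi_mul.comp_neg.mul hasJet_mul_psi))
  refine (h.congr (a' := 0) (b' := 0) (by norm_num) (by norm_num)).isBigO_nome_sq fun τ _ ↦ ?_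
  rw [cubic3, thetaProd3_eq, thetaProd4_eq, thetaProd2_eq, theta3_eq_phi, theta3_eq_phi,
    nome_three_mul]

lemma isBigO_cubic4 : cubic4 =O[comap Complex.im atTop] fun τ ↦ nome τ ^ 2 := by
  have h := ((((hasJet_phi_mul.comp_neg.pow 3).const_mul 10).sub (hasJet_phi.comp_neg.pow 7)).sub
    (((hasJet_phi.comp_pow 1).comp_neg.pow 7).const_mul 9)).add
    (((hasJet_phi_mul.comp_neg.pow 1).const_mul 16).mul (hasJet_phi_mul.mul hasJet_mul_psi))
  refine (h.congr (a' := 0) (b' := 0) (by norm_num) (by norm_num)).isBigO_nome_sq fun τ _ ↦ ?_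
  rw [cubic4, thetaProd3_eq, thetaProd4_eq, thetaProd2_eq, theta4_eq_phi, theta4_eq_phi,
    nome_three_mul, (by decide : Odd (1 + 2)).neg_pow]

lemma isBigO_cubic2 : cubic2 =O[comap Complex.im atTop] fun τ ↦ nome τ ^ 2 := by
  have h := ((((hasJet_mul_psi.pow 3).const_mul 10).sub
    ((HasJet.id.pow 1).mul (hasJet_psi.pow 7))).sub
    ((((HasJet.id.comp_pow 1).pow 1).mul ((hasJet_psi.comp_pow 1).pow 7)).const_mul 9)).add
    (((hasJet_mul_psi.pow 1).const_mul 16).mul (hasJet_phi_mul.mul hasJet_phi_mul.comp_neg))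
  refine (h.congr (a' := 0) (b' := 0) (by norm_num) (by norm_num)).isBigO_nome_sq fun τ _ ↦ ?_
  rw [cubic2, thetaProd3_eq, thetaProd4_eq, thetaProd2_eq, theta2_pow_eight, theta2_pow_eight,
    nome_three_mul]

lemma cubic3_eq_zero {τ : ℂ} (hτ : 0 < τ.im) : cubic3 τ = 0 := by
  have hP : ∀ τ : ℂ, 0 < τ.im → cubic2 τ * cubic3 τ * cubic4 τ = 0 := by
    refine eq_zero_of_fricke_of_isBigO
      ((differentiableOn_cubic2.mul differentiableOn_cubic3).mul differentiableOn_cubic4)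
      (fun τ hτ ↦ ?_) (fun τ hτ ↦ ?_) ?_
    · rw [cubic2_add_one, cubic3_add_one, cubic4_add_one]
      ring
    · have h0 := ne_zero_of_im_pos hτ
      rw [cubic2_fricke h0, cubic3_fricke h0, cubic4_fricke h0]
      ring
    · exact ((isBigO_cubic2.mul isBigO_cubic3).mul isBigO_cubic4).congr_right fun τ ↦ by ring
  have h4 (h : ∀ τ : ℂ, 0 < τ.im → cubic4 τ = 0) : cubic3 τ = 0 := by
    rw [← cubic4_add_one, h _ (by simpa using hτ)]
  rcases eqOn_zero_or_eqOn_zero_of_mul (differentiableOn_cubic2.mul differentiableOn_cubic3)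
    differentiableOn_cubic4 hP with h | h
  · rcases eqOn_zero_or_eqOn_zero_of_mul differentiableOn_cubic2 differentiableOn_cubic3 h
      with h | h
    · refine h4 fun τ hτ ↦ ?_
      have h0 := ne_zero_of_im_pos hτ
      have := cubic2_fricke h0
      rw [h _ (by simpa [mul_comm] using im_neg_one_div_pos (τ := 3 * τ) (by simpa using hτ))]
        at this
      simpa [h0] using this.symm
    · exact h τ hτ
  · exact h4 h

theorem phi_mul_phi_cube_pow_four {q : ℂ} (h0 : q ≠ 0) (hq : ‖q‖ < 1) :
    10 * (phi q * phi (q ^ 3)) ^ 4 = phi q ^ 8 + 9 * phi (q ^ 3) ^ 8 +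
      16 * (q * ((phi q ^ 2 * phi (-q) * psi q) *
        (phi (q ^ 3) ^ 2 * phi (-q ^ 3) * psi (q ^ 3)))) := by
  obtain ⟨τ, hτ, rfl⟩ := exists_nome_eq h0 hq
  have := cubic3_eq_zero hτ
  rw [cubic3, thetaProd3_eq, thetaProd4_eq, thetaProd2_eq, theta3_eq_phi, theta3_eq_phi,
    nome_three_mul, (by decide : Odd 3).neg_pow] at this
  linear_combination this

end CubicIdentity

section JacobiTripleProduct

open Complex Filter Topology

/-- The Euler product `∏_{n ≥ 1} (1 - qⁿ)`. -/
def eulerProd (q : ℂ) : ℂ := ∏' n : ℕ, (1 - q ^ (n + 1))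

lemma one_sub_pow_ne_zero {q : ℂ} (hq : ‖q‖ < 1) {n : ℕ} (hn : n ≠ 0) : 1 - q ^ n ≠ 0 := by
  intro h
  have : ‖q ^ n‖ < 1 := by rw [norm_pow]; exact pow_lt_one₀ (norm_nonneg q) hq hn
  rw [← sub_eq_zero.mp h, norm_one] at this
  exact this.false

lemma summable_norm_pow_linear {q : ℂ} (hq : ‖q‖ < 1) {d : ℕ} (hd : d ≠ 0) (e : ℕ) :
    Summable fun n : ℕ ↦ ‖q ^ (d * n + e)‖ := by
  have h : ‖q ^ d‖ < 1 := by rw [norm_pow]; exact pow_lt_one₀ (norm_nonneg q) hq hd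
  refine ((summable_geometric_of_lt_one (norm_nonneg _) h).mul_left (‖q‖ ^ e)).congr fun n ↦ ?_
  rw [norm_pow, norm_pow, ← pow_mul, ← pow_add, add_comm]

lemma multipliable_one_add_pow {q : ℂ} (hq : ‖q‖ < 1) {d : ℕ} (hd : d ≠ 0) (e : ℕ) :
    Multipliable fun n : ℕ ↦ 1 + q ^ (d * n + e) :=
  multipliable_one_add_of_summable (summable_norm_pow_linear hq hd e)

lemma multipliable_one_sub_pow_linear {q : ℂ} (hq : ‖q‖ < 1) {d : ℕ} (hd : d ≠ 0) (e : ℕ) :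
    Multipliable fun n : ℕ ↦ 1 - q ^ (d * n + e) := by
  have := multipliable_one_add_of_summable (f := fun n : ℕ ↦ -q ^ (d * n + e))
    (by simpa using summable_norm_pow_linear hq hd e)
  simpa [sub_eq_add_neg] using this

lemma hasProd_eulerProd {q : ℂ} (hq : ‖q‖ < 1) :
    HasProd (fun n : ℕ ↦ 1 - q ^ (n + 1)) (eulerProd q) := by
  simpa using! (multipliable_one_sub_pow_linear hq one_ne_zero 1).hasProd

lemma eulerProd_ne_zero {q : ℂ} (hq : ‖q‖ < 1) : eulerProd q ≠ 0 := by
  have := tprod_one_add_ne_zero_of_summable (f := fun n : ℕ ↦ -q ^ (n + 1))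
    (fun n ↦ by simpa [sub_eq_add_neg] using one_sub_pow_ne_zero hq n.succ_ne_zero)
    (by simpa using summable_norm_pow_linear hq one_ne_zero 1)
  simpa [eulerProd, sub_eq_add_neg] using this

/-- The finite product `(q; q)ₙ = ∏_{1 ≤ k ≤ n} (1 - q ^ k)`. -/
def qFactorial (q : ℂ) (n : ℕ) : ℂ := ∏ k ∈ Finset.range n, (1 - q ^ (k + 1))

/-- The inverse of `(q; q)ₘ`, extended by zero to negative `m`. -/
def invQFactorial (q : ℂ) (m : ℤ) : ℂ := if 0 ≤ m then (qFactorial q m.toNat)⁻¹ else 0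

lemma invQFactorial_sub_one {q : ℂ} (hq : ‖q‖ < 1) (m : ℤ) :
    invQFactorial q (m - 1) = (1 - q ^ m) * invQFactorial q m := by
  rcases lt_trichotomy m 0 with h | rfl | h
  · simp [invQFactorial, show ¬ 0 ≤ m by omega, show ¬ 1 ≤ m by omega]
  · simp [invQFactorial]
  · obtain ⟨k, rfl⟩ : ∃ k : ℕ, m = k + 1 := ⟨(m - 1).toNat, by omega⟩
    have hk := one_sub_pow_ne_zero hq k.succ_ne_zero
    have e : ((k : ℤ) + 1).toNat = k + 1 := by omega
    rw [invQFactorial, invQFactorial, if_pos (by omega), if_pos (by omega), e, add_sub_cancel_right,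
      Int.toNat_natCast, qFactorial, qFactorial, Finset.prod_range_succ, mul_inv]
    norm_cast
    rw [mul_comm, mul_assoc, inv_mul_cancel₀ hk, mul_one]

lemma tendsto_qFactorial {q : ℂ} (hq : ‖q‖ < 1) :
    Tendsto (qFactorial q) atTop (𝓝 (eulerProd q)) :=
  (hasProd_eulerProd hq).tendsto_prod_nat

lemma tendsto_invQFactorial {q : ℂ} (hq : ‖q‖ < 1) :
    Tendsto (invQFactorial q) atTop (𝓝 (eulerProd q)⁻¹) := by
  have h : Tendsto Int.toNat atTop atTop :=
    tendsto_atTop.mpr fun n ↦ (eventually_ge_atTop (n : ℤ)).mono fun m hm ↦ by omega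
  refine (((tendsto_qFactorial hq).comp h).inv₀ (eulerProd_ne_zero hq)).congr' ?_
  filter_upwards [eventually_ge_atTop 0] with m hm
  simp [invQFactorial, hm]

lemma exists_norm_qFactorial_le {q : ℂ} (hq : ‖q‖ < 1) : ∃ C, ∀ n, ‖qFactorial q n‖ ≤ C := by
  obtain ⟨C, hC⟩ := (Metric.isBounded_range_of_tendsto _ (tendsto_qFactorial hq)).exists_norm_le
  exact ⟨C, fun n ↦ hC _ ⟨n, rfl⟩⟩

lemma exists_norm_invQFactorial_le {q : ℂ} (hq : ‖q‖ < 1) :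
    ∃ C, ∀ m, ‖invQFactorial q m‖ ≤ C := by
  obtain ⟨C, hC⟩ := (Metric.isBounded_range_of_tendsto _
    ((tendsto_qFactorial hq).inv₀ (eulerProd_ne_zero hq))).exists_norm_le
  refine ⟨C, fun m ↦ ?_⟩
  rw [invQFactorial]
  split_ifs
  · exact hC _ ⟨m.toNat, rfl⟩
  · simpa using (norm_nonneg _).trans (hC _ ⟨0, rfl⟩)

/-- The finite form of the Jacobi triple product. -/
lemma hasSum_finite_jacobi_triple {q z : ℂ} (h0 : q ≠ 0) (hq : ‖q‖ < 1) (hz : z ≠ 0) (n : ℕ) :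
    HasSum (fun i : ℤ ↦ z ^ i * q ^ (i ^ 2) * (qFactorial (q ^ 2) (2 * n) *
        (invQFactorial (q ^ 2) (n - i) * invQFactorial (q ^ 2) (n + i))))
      (∏ k ∈ Finset.range n, ((1 + z * q ^ (2 * k + 1)) * (1 + z⁻¹ * q ^ (2 * k + 1)))) := by
  have hq2 : ‖q ^ 2‖ < 1 := by rw [norm_pow]; exact pow_lt_one₀ (norm_nonneg q) hq two_ne_zero
  induction n with
  | zero =>
    have h : ∀ i : ℤ, i ≠ 0 → z ^ i * q ^ (i ^ 2) * (qFactorial (q ^ 2) (2 * 0) *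
        (invQFactorial (q ^ 2) ((0 : ℕ) - i) * invQFactorial (q ^ 2) ((0 : ℕ) + i))) = 0 := by
      intro i hi
      rcases hi.lt_or_gt with h | h
      · simp [invQFactorial, show ¬ 0 ≤ i by omega]
      · simp [invQFactorial, show ¬ i ≤ 0 by omega]
    simpa [invQFactorial, qFactorial] using hasSum_single (0 : ℤ) h
  | succ n ih =>
    have h1 := (Equiv.subRight (1 : ℤ)).hasSum_iff.mpr ih
    have h2 := (Equiv.addRight (1 : ℤ)).hasSum_iff.mpr ih
    have h := (ih.mul_left (1 + q ^ (4 * n + 2))).add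
      ((h1.mul_left (q ^ (2 * n + 1) * z)).add (h2.mul_left (q ^ (2 * n + 1) * z⁻¹)))
    convert! h using 1
    · funext i
      simp only [Function.comp_apply, Equiv.subRight_apply, Equiv.coe_addRight]
      have e1 := invQFactorial_sub_one hq2 (n + 1 - i)
      have e2 := invQFactorial_sub_one hq2 (n + 1 + i)
      have e3 := invQFactorial_sub_one hq2 (n - i)
      have e4 := invQFactorial_sub_one hq2 (n + i)
      rw [show (n : ℤ) + 1 - i - 1 = n - i by ring] at e1
      rw [show (n : ℤ) + 1 + i - 1 = n + i by ring] at e2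
      rw [e1] at e3
      rw [e2] at e4
      have e5 : qFactorial (q ^ 2) (2 * (n + 1)) = qFactorial (q ^ 2) (2 * n) *
          (1 - (q ^ 2) ^ (2 * n + 1)) * (1 - (q ^ 2) ^ (2 * n + 2)) := by
        rw [qFactorial, show 2 * (n + 1) = 2 * n + 1 + 1 by ring, Finset.prod_range_succ,
          Finset.prod_range_succ, qFactorial]
      rw [show (n : ℤ) - (i - 1) = n + 1 - i by ring, show (n : ℤ) + (i - 1) = n + i - 1 by ring,
        show (n : ℤ) + (i + 1) = n + 1 + i by ring, show (n : ℤ) - (i + 1) = n - i - 1 by ring,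
        e1, e2, e3, e4, e5]
      push_cast
      generalize invQFactorial (q ^ 2) (n + 1 - i) = u
      generalize invQFactorial (q ^ 2) (n + 1 + i) = v
      have hq2' : q ^ 2 ≠ 0 := pow_ne_zero 2 h0
      have a1 : q ^ ((i - 1) ^ 2) = q ^ (i ^ 2) * q / (q ^ i) ^ 2 := by
        rw [show (i - 1) ^ 2 = i ^ 2 + 1 - i * 2 by ring, zpow_sub₀ h0, zpow_add₀ h0, zpow_mul,
          zpow_one]
        rfl
      have a2 : q ^ ((i + 1) ^ 2) = q ^ (i ^ 2) * q * (q ^ i) ^ 2 := by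
        rw [show (i + 1) ^ 2 = i ^ 2 + 1 + i * 2 by ring, zpow_add₀ h0, zpow_add₀ h0, zpow_mul,
          zpow_one]
        rfl
      have a3 : ∀ m : ℤ, (q ^ 2) ^ m = (q ^ m) ^ 2 := fun m ↦ by
        rw [← zpow_natCast, ← zpow_natCast, ← zpow_mul, ← zpow_mul, mul_comm]
      have a4 : (q ^ 2) ^ (2 * n + 1) = (q ^ n) ^ 4 * q ^ 2 := by ring
      have a5 : (q ^ 2) ^ (2 * n + 2) = (q ^ n) ^ 4 * q ^ 4 := by ring
      have a6 : q ^ (4 * n + 2) = (q ^ n) ^ 4 * q ^ 2 := by ring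
      have a7 : q ^ (2 * n + 1) = (q ^ n) ^ 2 * q := by ring
      rw [a1, a2, a3, a3, a3, a3, a4, a5, a6, a7]
      simp only [zpow_sub₀ h0, zpow_add₀ h0, zpow_sub₀ hz, zpow_add₀ hz, zpow_natCast, zpow_one]
      have hy : q ^ i ≠ 0 := zpow_ne_zero i h0
      generalize q ^ i = y at hy ⊢
      generalize q ^ n = x
      generalize q ^ (i ^ 2) = w
      generalize z ^ i = t
      field_simp
      ring
    · rw [Finset.prod_range_succ]
      field_simp
      ring

/-- The Jacobi triple product identity. -/
theorem tendsto_jacobi_triple {q z : ℂ} (h0 : q ≠ 0) (hq : ‖q‖ < 1) (hz : z ≠ 0)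
    (hs : Summable fun i : ℤ ↦ z ^ i * q ^ (i ^ 2)) :
    Tendsto (fun n ↦ ∏ k ∈ Finset.range n,
        ((1 + z * q ^ (2 * k + 1)) * (1 + z⁻¹ * q ^ (2 * k + 1)))) atTop
      (𝓝 ((∑' i : ℤ, z ^ i * q ^ (i ^ 2)) * (eulerProd (q ^ 2))⁻¹)) := by
  have hq2 : ‖q ^ 2‖ < 1 := by rw [norm_pow]; exact pow_lt_one₀ (norm_nonneg q) hq two_ne_zero
  obtain ⟨C, hC⟩ := exists_norm_qFactorial_le hq2
  obtain ⟨D, hD⟩ := exists_norm_invQFactorial_le hq2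
  have hC0 := (norm_nonneg _).trans (hC 0)
  have hD0 := (norm_nonneg _).trans (hD 0)
  have := tendsto_tsum_of_dominated_convergence (𝓕 := atTop)
    (f := fun (n : ℕ) (i : ℤ) ↦ z ^ i * q ^ (i ^ 2) * (qFactorial (q ^ 2) (2 * n) *
        (invQFactorial (q ^ 2) (n - i) * invQFactorial (q ^ 2) (n + i))))
    (g := fun i : ℤ ↦ z ^ i * q ^ (i ^ 2) *
      (eulerProd (q ^ 2) * ((eulerProd (q ^ 2))⁻¹ * (eulerProd (q ^ 2))⁻¹)))
    (bound := fun i ↦ ‖z ^ i * q ^ (i ^ 2)‖ * (C * (D * D))) (hs.norm.mul_right _) (fun i ↦ ?_)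
    (.of_forall fun n i ↦ ?_)
  · refine (this.congr fun n ↦ (hasSum_finite_jacobi_triple h0 hq hz n).tsum_eq).trans ?_
    rw [tsum_mul_right, mul_inv_cancel_left₀ (eulerProd_ne_zero hq2)]
  · have hn : Tendsto (fun n : ℕ ↦ (n : ℤ)) atTop atTop := tendsto_natCast_atTop_atTop
    refine .const_mul _ (.mul ((tendsto_qFactorial hq2).comp
      (tendsto_id.const_mul_atTop' two_pos)) (.mul ?_ ?_))
    · exact (tendsto_invQFactorial hq2).comp (tendsto_atTop_add_const_right _ (-i) hn)
    · exact (tendsto_invQFactorial hq2).comp (tendsto_atTop_add_const_right _ i hn)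
  · rw [norm_mul, norm_mul (qFactorial _ _), norm_mul (invQFactorial _ _)]
    gcongr
    exacts [hC _, hD _, hD _]

end JacobiTripleProduct

section EtaQuotient

open Complex Filter Topology

/-- The product `∏_{n ≥ 0} (1 + q ^ (2 n + 1))`. -/
def oddProd (q : ℂ) : ℂ := ∏' n : ℕ, (1 + q ^ (2 * n + 1))

/-- The product `∏_{n ≥ 1} (1 + q ^ (2 n))`. -/
def evenProd (q : ℂ) : ℂ := ∏' n : ℕ, (1 + q ^ (2 * n + 2))

lemma hasProd_oddProd {q : ℂ} (hq : ‖q‖ < 1) :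
    HasProd (fun n : ℕ ↦ 1 + q ^ (2 * n + 1)) (oddProd q) :=
  (multipliable_one_add_pow hq two_ne_zero 1).hasProd

lemma hasProd_oddProd_neg {q : ℂ} (hq : ‖q‖ < 1) :
    HasProd (fun n : ℕ ↦ 1 - q ^ (2 * n + 1)) (oddProd (-q)) := by
  refine (hasProd_oddProd (q := -q) (by simpa using hq)).congr_fun fun n ↦ ?_
  rw [(odd_two_mul_add_one n).neg_pow, sub_eq_add_neg]

lemma hasProd_evenProd {q : ℂ} (hq : ‖q‖ < 1) :
    HasProd (fun n : ℕ ↦ 1 + q ^ (2 * n + 2)) (evenProd q) :=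
  (multipliable_one_add_pow hq two_ne_zero 2).hasProd

lemma phi_eq_prod {q : ℂ} (h0 : q ≠ 0) (hq : ‖q‖ < 1) :
    phi q = eulerProd (q ^ 2) * oddProd q ^ 2 := by
  have hq2 : ‖q ^ 2‖ < 1 := by rw [norm_pow]; exact pow_lt_one₀ (norm_nonneg q) hq two_ne_zero
  have h1 := tendsto_jacobi_triple h0 hq one_ne_zero (by simpa using (hasSum_pow_sq hq).summable)
  have h2 := ((hasProd_oddProd hq).mul (hasProd_oddProd hq)).tendsto_prod_nat
  simp only [one_zpow, one_mul, inv_one] at h1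
  have h := tendsto_nhds_unique h1 h2
  rw [mul_inv_eq_iff_eq_mul₀ (eulerProd_ne_zero hq2)] at h
  rw [phi, h]
  ring

lemma psi_eq_prod {q : ℂ} (h0 : q ≠ 0) (hq : ‖q‖ < 1) :
    psi q = 2 * eulerProd (q ^ 2) * evenProd q ^ 2 := by
  have hq2 : ‖q ^ 2‖ < 1 := by rw [norm_pow]; exact pow_lt_one₀ (norm_nonneg q) hq two_ne_zero
  have he : ∀ i : ℤ, q ^ i * q ^ (i ^ 2) = q ^ (i ^ 2 + i) := fun i ↦ by
    rw [zpow_add₀ h0, mul_comm]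
  have h1 := tendsto_jacobi_triple h0 hq h0
    (by simpa only [he] using (hasSum_pow_sq_add hq).summable)
  have h3 : HasProd (fun n : ℕ ↦ 1 + q⁻¹ * q ^ (2 * n + 1)) ((1 + q ^ 0) * evenProd q) := by
    have := (hasProd_evenProd hq).zero_mul (f := fun n : ℕ ↦ 1 + q ^ (2 * n))
    refine this.congr_fun fun n ↦ ?_
    rw [pow_succ', inv_mul_cancel_left₀ h0]
  have h4 : HasProd (fun n : ℕ ↦ 1 + q * q ^ (2 * n + 1)) (evenProd q) :=
    (hasProd_evenProd hq).congr_fun fun n ↦ by ring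
  have h := tendsto_nhds_unique h1 (h4.mul h3).tendsto_prod_nat
  simp only [he] at h
  rw [mul_inv_eq_iff_eq_mul₀ (eulerProd_ne_zero hq2)] at h
  rw [psi, h]
  ring

lemma eulerProd_eq_odd_mul {q : ℂ} (hq : ‖q‖ < 1) :
    eulerProd q = oddProd (-q) * eulerProd (q ^ 2) := by
  have hq2 : ‖q ^ 2‖ < 1 := by rw [norm_pow]; exact pow_lt_one₀ (norm_nonneg q) hq two_ne_zero
  refine (hasProd_eulerProd hq).unique (HasProd.even_mul_odd (hasProd_oddProd_neg hq) ?_)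
  exact (hasProd_eulerProd hq2).congr_fun fun n ↦ by ring

lemma eulerProd_sq_eq {q : ℂ} (hq : ‖q‖ < 1) :
    eulerProd (q ^ 2) = oddProd q * oddProd (-q) * eulerProd (q ^ 4) := by
  have hq2 : ‖q ^ 2‖ < 1 := by rw [norm_pow]; exact pow_lt_one₀ (norm_nonneg q) hq two_ne_zero
  have h : HasProd (fun n : ℕ ↦ 1 - (q ^ 2) ^ (2 * n + 1)) (oddProd q * oddProd (-q)) :=
    ((hasProd_oddProd hq).mul (hasProd_oddProd_neg hq)).congr_fun fun n ↦ by ring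
  rw [eulerProd_eq_odd_mul hq2, (hasProd_oddProd_neg hq2).unique h, ← pow_mul]

lemma eulerProd_pow_four {q : ℂ} (hq : ‖q‖ < 1) :
    eulerProd (q ^ 4) = eulerProd (q ^ 2) * evenProd q := by
  have hq2 : ‖q ^ 2‖ < 1 := by rw [norm_pow]; exact pow_lt_one₀ (norm_nonneg q) hq two_ne_zero
  have hq4 : ‖q ^ 4‖ < 1 := by rw [norm_pow]; exact pow_lt_one₀ (norm_nonneg q) hq four_ne_zero
  refine (hasProd_eulerProd hq4).unique
    (((hasProd_eulerProd hq2).mul (hasProd_evenProd hq)).congr_fun fun n ↦ by ring)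

/-- An eta quotient as a product of theta functions. -/
lemma hasProd_eta_quotient {q : ℂ} (h0 : q ≠ 0) (hq : ‖q‖ < 1) :
    HasProd (fun n : ℕ ↦ (1 - (q ^ 2) ^ (n + 1)) ^ 8 /
      ((1 - q ^ (n + 1)) ^ 2 * (1 - (q ^ 4) ^ (n + 1)) ^ 2))
      (phi q ^ 2 * phi (-q) * psi q / 2) := by
  have hq2 : ‖q ^ 2‖ < 1 := by rw [norm_pow]; exact pow_lt_one₀ (norm_nonneg q) hq two_ne_zero
  have hq4 : ‖q ^ 4‖ < 1 := by rw [norm_pow]; exact pow_lt_one₀ (norm_nonneg q) hq four_ne_zero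
  have h : phi q ^ 2 * phi (-q) * psi q / 2 =
      eulerProd (q ^ 2) ^ 8 / (eulerProd q ^ 2 * eulerProd (q ^ 4) ^ 2) := by
    have hE := eulerProd_ne_zero hq2
    have h4 := eulerProd_sq_eq hq
    rw [eq_div_iff (mul_ne_zero (pow_ne_zero 2 (eulerProd_ne_zero hq))
      (pow_ne_zero 2 (eulerProd_ne_zero hq4))), phi_eq_prod h0 hq,
      phi_eq_prod (neg_ne_zero.mpr h0) (by simpa using hq), psi_eq_prod h0 hq,
      eulerProd_eq_odd_mul hq, neg_sq]
    rw [eulerProd_pow_four hq] at h4 ⊢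
    have h5 : oddProd q * oddProd (-q) * evenProd q = 1 :=
      mul_left_cancel₀ hE (by linear_combination -h4)
    linear_combination eulerProd (q ^ 2) ^ 8 *
      ((oddProd q * oddProd (-q) * evenProd q) ^ 2 + 1) *
      (oddProd q * oddProd (-q) * evenProd q + 1) * h5
  rw [h]
  exact ((hasProd_eulerProd hq2).pow 8).div₀
    (((hasProd_eulerProd hq).pow 2).mul ((hasProd_eulerProd hq4).pow 2))
    (mul_ne_zero (pow_ne_zero 2 (eulerProd_ne_zero hq)) (pow_ne_zero 2 (eulerProd_ne_zero hq4)))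

lemma hasSum_lambert_pow {q : ℂ} (hq : ‖q‖ < 1) {d : ℕ} (hd : d ≠ 0) :
    HasSum (fun j : ℕ ↦ ((j : ℂ) + 1) ^ 3 * q ^ (d * (j + 1)) / (1 - q ^ (d * (j + 1))))
      (lambert (q ^ d)) := by
  have h : ‖q ^ d‖ < 1 := by rw [norm_pow]; exact pow_lt_one₀ (norm_nonneg q) hq hd
  simpa only [pow_mul, lambert] using (summable_lambert h).hasSum

end EtaQuotient

theorem statement13 (q : ℂ) (hq : ‖q‖ < 1) :
    (∑' n : ℤ, (q) ^ (n ^ 2)) ^ 4 * (∑' n : ℤ, (q ^ 3) ^ (n ^ 2)) ^ 4 =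
      1 + (8 / 5) * ∑' j : ℕ,
        (((j : ℂ) + 1) ^ 3 * q ^ (1 * (j + 1)) / (1 - q ^ (1 * (j + 1))) - 2 * ((j : ℂ) + 1) ^ 3 * q ^ (2 * (j + 1)) / (1 - q ^ (2 * (j + 1))) + 9 * ((j : ℂ) + 1) ^ 3 * q ^ (3 * (j + 1)) / (1 - q ^ (3 * (j + 1)))
          + 16 * ((j : ℂ) + 1) ^ 3 * q ^ (4 * (j + 1)) / (1 - q ^ (4 * (j + 1))) - 18 * ((j : ℂ) + 1) ^ 3 * q ^ (6 * (j + 1)) / (1 - q ^ (6 * (j + 1))) + 144 * ((j : ℂ) + 1) ^ 3 * q ^ (12 * (j + 1)) / (1 - q ^ (12 * (j + 1))))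
        + (32 / 5) * (q * ∏' n : ℕ, ((1 - q ^ (2 * (n + 1))) ^ 8 * (1 - q ^ (6 * (n + 1))) ^ 8 / ((1 - q ^ (1 * (n + 1))) ^ 2 * (1 - q ^ (3 * (n + 1))) ^ 2 * (1 - q ^ (4 * (n + 1))) ^ 2 * (1 - q ^ (12 * (n + 1))) ^ 2))) := by
  rcases eq_or_ne q 0 with rfl | h0
  · have h : ∑' n : ℤ, (0 : ℂ) ^ (n ^ 2) = 1 := by
      rw [tsum_eq_single 0 fun n hn ↦ zero_zpow _ (pow_ne_zero 2 hn)]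
      simp
    simp [h]
  have h3 : ‖q ^ 3‖ < 1 := by rw [norm_pow]; exact pow_lt_one₀ (norm_nonneg q) hq three_ne_zero
  have h30 : q ^ 3 ≠ 0 := pow_ne_zero 3 h0
  have hp : HasProd (fun n : ℕ ↦ (1 - q ^ (2 * (n + 1))) ^ 8 * (1 - q ^ (6 * (n + 1))) ^ 8 /
      ((1 - q ^ (1 * (n + 1))) ^ 2 * (1 - q ^ (3 * (n + 1))) ^ 2 * (1 - q ^ (4 * (n + 1))) ^ 2 *
        (1 - q ^ (12 * (n + 1))) ^ 2)) _ :=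
    ((hasProd_eta_quotient h0 hq).mul (hasProd_eta_quotient h30 h3)).congr_fun fun n ↦ by
      rw [div_mul_div_comm]
      simp only [← pow_mul, one_mul, Nat.reduceMul]
      ring
  have hs := (((((hasSum_lambert_pow hq one_ne_zero).sub
    ((hasSum_lambert_pow hq two_ne_zero).mul_left 2)).add
    ((hasSum_lambert_pow hq three_ne_zero).mul_left 9)).add
    ((hasSum_lambert_pow hq four_ne_zero).mul_left 16)).sub
    ((hasSum_lambert_pow hq (d := 6) (by norm_num)).mul_left 18)).add
    ((hasSum_lambert_pow hq (d := 12) (by norm_num)).mul_left 144)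
  have e1 := phi_mul_phi_cube_pow_four h0 hq
  rw [phi_pow_eight h0 hq, phi_pow_eight h30 h3, ← pow_mul, ← pow_mul] at e1
  rw [hp.tprod_eq, ← mul_pow]
  simp only [← mul_div_assoc, ← mul_assoc, pow_one] at hs
  rw [hs.tsum_eq]
  change (phi q * phi (q ^ 3)) ^ 4 = _
  linear_combination e1 / 10
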